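/- arXiv:1008.1724 — 3 statements merged into one kernel-verified Lean document; each statement's English description precedes it below -/
import Mathlib

section
/- Let W ⊊ ℂ be a domain and let K be a nonempty closed subset of the boundary of W in ℂ∞, i.e. of (closure of W in ℂ∞) ∖ W. Then there exist a holomorphic function g : W → ℂ, points z_k ∈ W and radii r_k > 0 (k ∈ ℕ) such that: the closed disks cl B(z_k, r_k) are pairwise disjoint and contained in W; g(cl B(z_k, r_k)) ⊆ B(z_{k+1}, r_{k+1}) for all k; r_k → 0 as k → ∞; and the accumulation set of the sequence (z_k) in ℂ∞ equals K. -/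
open Set Filter Topology Metric

/-- In a separable metric space, every nonempty closed set is the set of subsequential limits of
each sequence asymptotic to a suitable sequence of its points. -/
theorem IsClosed.exists_seq_setOf_subseq_limits_eq {X : Type*} [MetricSpace X]
    [SecondCountableTopology X] {K : Set X} (hK : IsClosed K) (hne : K.Nonempty) :
    ∃ p : ℕ → X, (∀ n, p n ∈ K) ∧ ∀ x : ℕ → X,
      Tendsto (fun n => dist (x n) (p n)) atTop (𝓝 0) →
      {w | ∃ k : ℕ → ℕ, StrictMono k ∧ Tendsto (fun j => x (k j)) atTop (𝓝 w)} = K := by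
  have : Nonempty K := hne.to_subtype
  obtain ⟨q, hq⟩ := TopologicalSpace.exists_dense_seq K
  refine ⟨fun n => q n.unpair.1, fun n => (q n.unpair.1).2, fun x hx => ?_⟩
  ext w
  constructor
  · rintro ⟨k, hk, hlim⟩
    refine hK.mem_of_tendsto ((tendsto_iff_of_dist ?_).1 hlim)
      (Eventually.of_forall fun j => (q (k j).unpair.1).2)
    exact hx.comp hk.tendsto_atTop
  · intro hw
    refine MapClusterPt.tendsto_subseq (u := x) ?_
    refine nhds_basis_ball.mapClusterPt_iff_frequently.2 fun ε hε => ?_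
    obtain ⟨m, hm⟩ := hq.exists_dist_lt (⟨w, hw⟩ : K) (half_pos hε)
    have hev : ∀ᶠ n in atTop, dist (x n) (q n.unpair.1) < ε / 2 :=
      (tendsto_order.1 hx).2 _ (half_pos hε)
    have hfr : ∃ᶠ n : ℕ in atTop, n.unpair.1 = m :=
      frequently_atTop.2 fun j => ⟨Nat.pair m j, Nat.right_le_pair m j, by simp⟩
    refine (hfr.and_eventually hev).mono fun n ⟨hnm, hn⟩ => ?_
    rw [hnm] at hn
    have hm' : dist w (q m) < ε / 2 := hm
    rw [mem_ball]
    linarith [dist_triangle_right (x n) w (q m)]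

/-- Near a boundary point `p` of `W` on the Riemann sphere there are points `z ∈ W` admitting a
holomorphic function on `W` that equals `1` at `z` and is small on a given compact set. -/
theorem exists_mem_differentiableOn_eq_one_and_norm_le {W C : Set ℂ} {p : OnePoint ℂ}
    {U : Set (OnePoint ℂ)}
    (hp : p ∈ closure ((fun w : ℂ => (w : OnePoint ℂ)) '' W) \
        ((fun w : ℂ => (w : OnePoint ℂ)) '' W))
    (hC : IsCompact C) (hCW : C ⊆ W) (hU : U ∈ 𝓝 p) :
    ∃ z ∈ W, (z : OnePoint ℂ) ∈ U ∧ ∃ u : ℂ → ℂ, DifferentiableOn ℂ u W ∧ u z = 1 ∧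
      ∀ x ∈ C, ‖u x‖ ≤ 1 / 4 := by
  obtain ⟨hcl, hpW⟩ := hp
  rw [mem_closure_iff_nhds] at hcl
  induction p using OnePoint.rec with
  | infty =>
    obtain ⟨R, hR⟩ := hC.isBounded.exists_norm_le
    have hV : ((fun w : ℂ => (w : OnePoint ℂ)) '' closedBall 0 (4 * |R|))ᶜ
        ∈ 𝓝 (OnePoint.infty : OnePoint ℂ) :=
      (OnePoint.isOpen_compl_image_coe.2 ⟨isClosed_closedBall, isCompact_closedBall _ _⟩).mem_nhds
        (by simp)
    obtain ⟨_, ⟨hzU, hzV⟩, z, hzW, rfl⟩ := hcl _ (inter_mem hU hV)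
    have hz : 4 * |R| < ‖z‖ := by
      by_contra! h
      exact hzV ⟨z, by simpa using h, rfl⟩
    have hz0 : 0 < ‖z‖ := by linarith [abs_nonneg R]
    refine ⟨z, hzW, hzU, fun x => x / z, by fun_prop, div_self (norm_pos_iff.1 hz0),
      fun x hx => ?_⟩
    rw [norm_div, div_le_iff₀ hz0]
    linarith [hR x hx, le_abs_self R]
  | coe a =>
    have haW : a ∉ W := fun h => hpW ⟨a, h, rfl⟩
    obtain ⟨δ, hδ, hδC⟩ : ∃ δ > 0, ball a δ ⊆ Cᶜ :=
      Metric.mem_nhds_iff.1 (hC.isClosed.isOpen_compl.mem_nhds fun h => haW (hCW h))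
    have hV : (fun w : ℂ => (w : OnePoint ℂ)) '' ball a (δ / 4) ∈ 𝓝 (a : OnePoint ℂ) :=
      (OnePoint.isOpen_image_coe.2 isOpen_ball).mem_nhds ⟨a, mem_ball_self (by positivity), rfl⟩
    obtain ⟨_, ⟨hzU, y, hy, hyz⟩, z, hzW, rfl⟩ := hcl _ (inter_mem hU hV)
    obtain rfl : y = z := OnePoint.coe_injective hyz
    have hne : ∀ x ∈ W, x - a ≠ 0 := fun x hx h => haW (sub_eq_zero.1 h ▸ hx)
    refine ⟨y, hzW, hzU, fun x => (y - a) / (x - a), ?_, div_self (hne y hzW), fun x hx => ?_⟩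
    · exact (differentiableOn_const _).div (by fun_prop) hne
    · have hxa : δ ≤ ‖x - a‖ := by
        by_contra! h
        exact hδC (mem_ball_iff_norm.2 h) hx
      rw [norm_div, div_le_iff₀ (by linarith)]
      linarith [mem_ball_iff_norm.1 hy]

/-- The cubic `x ↦ x² (3 - 2x)`, for which `0` and `1` are superattracting fixed points. -/
def smoothstepCubic (x : ℂ) : ℂ := x ^ 2 * (3 - 2 * x)

theorem smoothstepCubic_one_sub (x : ℂ) : smoothstepCubic (1 - x) = 1 - smoothstepCubic x := by
  simp only [smoothstepCubic]; ring

theorem differentiable_smoothstepCubic : Differentiable ℂ smoothstepCubic := by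
  unfold smoothstepCubic; fun_prop

theorem norm_smoothstepCubic_le {x : ℂ} (hx : ‖x‖ ≤ 1 / 4) :
    ‖smoothstepCubic x‖ ≤ 7 / 8 * ‖x‖ := by
  have h : ‖3 - 2 * x‖ ≤ 7 / 2 := by
    calc ‖3 - 2 * x‖ ≤ ‖(3 : ℂ)‖ + ‖2 * x‖ := norm_sub_le _ _
      _ ≤ 7 / 2 := by rw [norm_mul]; norm_num; linarith
  calc ‖smoothstepCubic x‖ = ‖x‖ * (‖x‖ * ‖3 - 2 * x‖) := by
        rw [smoothstepCubic, norm_mul, norm_pow]; ring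
    _ ≤ ‖x‖ * (1 / 4 * (7 / 2)) := by gcongr
    _ = 7 / 8 * ‖x‖ := by ring

theorem norm_iterate_smoothstepCubic_le {x : ℂ} (hx : ‖x‖ ≤ 1 / 4) (k : ℕ) :
    ‖smoothstepCubic^[k] x‖ ≤ (7 / 8) ^ k * (1 / 4) := by
  induction k with
  | zero => simpa using hx
  | succ k ih =>
    rw [Function.iterate_succ_apply']
    have hk : (7 / 8 : ℝ) ^ k ≤ 1 := pow_le_one₀ (by norm_num) (by norm_num)
    refine (norm_smoothstepCubic_le (by linarith)).trans ?_
    rw [pow_succ]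
    linarith

theorem norm_iterate_smoothstepCubic_sub_one_le {x : ℂ} (hx : ‖x - 1‖ ≤ 1 / 4) (k : ℕ) :
    ‖smoothstepCubic^[k] x - 1‖ ≤ (7 / 8) ^ k * (1 / 4) := by
  have h : smoothstepCubic^[k] (1 - x) = 1 - smoothstepCubic^[k] x :=
    ((show Function.Semiconj (fun y : ℂ => 1 - y) smoothstepCubic smoothstepCubic from
      fun y => (smoothstepCubic_one_sub y).symm).iterate_right k x).symm
  rw [norm_sub_rev] at hx ⊢
  rw [← h]
  exact norm_iterate_smoothstepCubic_le hx k

/-- Two compact sets separated by the values of a holomorphic function can be told apart by a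
holomorphic function close to `0` on one of them and close to a prescribed `h` on the other. -/
theorem exists_differentiableOn_norm_le_and_norm_sub_le {W C D : Set ℂ} {u h : ℂ → ℂ}
    (hC : IsCompact C) (hCW : C ⊆ W) (hD : IsCompact D) (hDW : D ⊆ W)
    (hu : DifferentiableOn ℂ u W) (hh : DifferentiableOn ℂ h W)
    (huC : ∀ x ∈ C, ‖u x‖ ≤ 1 / 4) (huD : ∀ x ∈ D, ‖u x - 1‖ ≤ 1 / 4) {ε : ℝ} (hε : 0 < ε) :
    ∃ e : ℂ → ℂ, DifferentiableOn ℂ e W ∧ (∀ x ∈ C, ‖e x‖ ≤ ε) ∧ ∀ x ∈ D, ‖e x - h x‖ ≤ ε := by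
  obtain ⟨M, hM⟩ := (hC.union hD).exists_bound_of_continuousOn
    (hh.continuousOn.mono (union_subset hCW hDW))
  have hlim : Tendsto (fun k : ℕ => (7 / 8 : ℝ) ^ k * (1 / 4) * |M|) atTop (𝓝 0) := by
    have h := ((tendsto_pow_atTop_nhds_zero_of_lt_one (r := (7 / 8 : ℝ)) (by norm_num)
      (by norm_num)).mul_const (1 / 4)).mul_const |M|
    rwa [zero_mul, zero_mul] at h
  obtain ⟨k, hk⟩ := ((tendsto_order.1 hlim).2 ε hε).exists
  refine ⟨fun x => smoothstepCubic^[k] (u x) * h x,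
    ((differentiable_smoothstepCubic.iterate k).comp_differentiableOn hu).mul hh,
    fun x hx => ?_, fun x hx => ?_⟩
  · refine le_trans ?_ hk.le
    rw [norm_mul]
    exact mul_le_mul (norm_iterate_smoothstepCubic_le (huC x hx) k)
      ((hM x (Or.inl hx)).trans (le_abs_self M)) (norm_nonneg _) (by positivity)
  · refine le_trans ?_ hk.le
    rw [show smoothstepCubic^[k] (u x) * h x - h x = (smoothstepCubic^[k] (u x) - 1) * h x by ring,
      norm_mul]
    exact mul_le_mul (norm_iterate_smoothstepCubic_sub_one_le (huD x hx) k)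
      ((hM x (Or.inr hx)).trans (le_abs_self M)) (norm_nonneg _) (by positivity)

/-- An open set of the plane is exhausted by a sequence of compact subsets absorbing every compact
subset. -/
theorem IsOpen.exists_seq_isCompact_absorbing {W : Set ℂ} (hW : IsOpen W) :
    ∃ E : ℕ → Set ℂ, (∀ n, IsCompact (E n)) ∧ (∀ n, E n ⊆ W) ∧
      ∀ s ⊆ W, IsCompact s → ∃ n, s ⊆ E n := by
  have : LocallyCompactSpace W := hW.locallyCompactSpace
  let E : CompactExhaustion W := default
  refine ⟨fun n => (↑) '' E n, fun n => (E.isCompact n).image continuous_subtype_val,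
    fun n => Subtype.coe_image_subset _ _, fun s hsW hs => ?_⟩
  have hs' : IsCompact ((↑) ⁻¹' s : Set W) := by
    rwa [Subtype.isCompact_iff, Subtype.image_preimage_coe, inter_eq_right.2 hsW]
  obtain ⟨n, hn⟩ := E.exists_superset_of_isCompact hs'
  exact ⟨n, fun x hx => ⟨⟨x, hsW hx⟩, hn hx, rfl⟩⟩

/-- Small disks centred near prescribed boundary points, each separated by a holomorphic function
from a compact set that contains all earlier ones, these compact sets exhausting `W`. -/
theorem exists_seq_closedBall_separated {W : Set ℂ} (hW : IsOpen W)
    {U : ℕ → Set (OnePoint ℂ)} {p : ℕ → OnePoint ℂ}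
    (hp : ∀ n, p n ∈ closure ((fun w : ℂ => (w : OnePoint ℂ)) '' W) \
        ((fun w : ℂ => (w : OnePoint ℂ)) '' W)) (hU : ∀ n, U n ∈ 𝓝 (p n)) :
    ∃ (C : ℕ → Set ℂ) (z : ℕ → ℂ) (r : ℕ → ℝ) (u : ℕ → ℂ → ℂ),
      (∀ n, IsCompact (C n)) ∧ (∀ n, C n ⊆ W) ∧ Monotone C ∧
      (∀ s ⊆ W, IsCompact s → ∃ n, s ⊆ C n) ∧
      (∀ n, closedBall (z n) (r n) ⊆ C (n + 1)) ∧ (∀ n, (z n : OnePoint ℂ) ∈ U n) ∧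
      (∀ n, 0 < r n) ∧ (∀ n, r n ≤ 1 / (n + 1)) ∧ Antitone r ∧
      (∀ n, DifferentiableOn ℂ (u n) W) ∧ (∀ n, ∀ x ∈ C n, ‖u n x‖ ≤ 1 / 4) ∧
      ∀ n, ∀ x ∈ closedBall (z n) (r n), ‖u n x - 1‖ ≤ 1 / 4 := by
  obtain ⟨E, hEc, hEW, hE⟩ := hW.exists_seq_isCompact_absorbing
  let State := {s : Set ℂ × ℝ // IsCompact s.1 ∧ s.1 ⊆ W ∧ 0 < s.2}
  have step : ∀ (n : ℕ) (s : State), ∃ (t : State) (z : ℂ) (u : ℂ → ℂ),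
      s.1.1 ⊆ t.1.1 ∧ E n ⊆ t.1.1 ∧ closedBall z t.1.2 ⊆ t.1.1 ∧ (z : OnePoint ℂ) ∈ U n ∧
      t.1.2 ≤ 1 / (n + 1) ∧ t.1.2 ≤ s.1.2 ∧ DifferentiableOn ℂ u W ∧
      (∀ x ∈ s.1.1, ‖u x‖ ≤ 1 / 4) ∧ ∀ x ∈ closedBall z t.1.2, ‖u x - 1‖ ≤ 1 / 4 := by
    rintro n ⟨⟨C, ρ⟩, hC, hCW, hρ⟩
    obtain ⟨z, hzW, hzU, u, hu, huz, huC⟩ :=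
      exists_mem_differentiableOn_eq_one_and_norm_le (hp n) hC hCW (hU n)
    have hnhds : W ∩ {x | ‖u x - 1‖ < 1 / 4} ∈ 𝓝 z := by
      refine inter_mem (hW.mem_nhds hzW) ?_
      have hc : ContinuousAt (fun x => ‖u x - 1‖) z :=
        ((hu.continuousOn.continuousAt (hW.mem_nhds hzW)).sub continuousAt_const).norm
      exact hc.eventually_lt continuousAt_const (by simp [huz])
    obtain ⟨δ, hδ, hδs⟩ := nhds_basis_closedBall.mem_iff.1 hnhds
    have hsub : closedBall z (min δ (min ρ (1 / (n + 1)))) ⊆ closedBall z δ :=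
      closedBall_subset_closedBall (min_le_left _ _)
    refine ⟨⟨(C ∪ E n ∪ closedBall z (min δ (min ρ (1 / (n + 1)))), min δ (min ρ (1 / (n + 1)))),
      (hC.union (hEc n)).union (isCompact_closedBall _ _),
      union_subset (union_subset hCW (hEW n)) fun x hx => (hδs (hsub hx)).1, by positivity⟩,
      z, u, fun x hx => Or.inl (Or.inl hx), fun x hx => Or.inl (Or.inr hx), fun x hx => Or.inr hx,
      hzU, (min_le_right _ _).trans (min_le_right _ _), (min_le_right _ _).trans (min_le_left _ _),
      hu, huC, fun x hx => (hδs (hsub hx)).2.le⟩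
  choose T z u hCT hET hBT hzU hrn hrs hu huC huB using step
  let s : ℕ → State := fun n => Nat.rec ⟨(∅, 1), isCompact_empty, empty_subset _, one_pos⟩ T n
  have hmono : Monotone fun n => (s n).1.1 := monotone_nat_of_le_succ fun n => hCT n (s n)
  refine ⟨fun n => (s n).1.1, fun n => z n (s n), fun n => (s (n + 1)).1.2, fun n => u n (s n),
    fun n => (s n).2.1, fun n => (s n).2.2.1, hmono, fun t htW ht => ?_, fun n => hBT n (s n),
    fun n => hzU n (s n), fun n => (s (n + 1)).2.2.2, fun n => hrn n (s n),
    antitone_nat_of_succ_le fun n => hrs (n + 1) (s (n + 1)), fun n => hu n (s n),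
    fun n => huC n (s n), fun n => huB n (s n)⟩
  obtain ⟨n, hn⟩ := hE t htW ht
  exact ⟨n + 1, hn.trans (hET n (s n))⟩

/-- Holomorphic functions on `W` may be chosen to be as close as desired to prescribed constants on
an exhausting sequence of separated compact sets. -/
theorem exists_differentiableOn_norm_sub_lt {W : Set ℂ} (hW : IsOpen W) {C D : ℕ → Set ℂ}
    {u : ℕ → ℂ → ℂ} (hC : ∀ n, IsCompact (C n)) (hCW : ∀ n, C n ⊆ W) (hCmono : Monotone C)
    (hCexh : ∀ s ⊆ W, IsCompact s → ∃ n, s ⊆ C n) (hD : ∀ n, IsCompact (D n))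
    (hDC : ∀ n, D n ⊆ C (n + 1)) (hu : ∀ n, DifferentiableOn ℂ (u n) W)
    (huC : ∀ n, ∀ x ∈ C n, ‖u n x‖ ≤ 1 / 4) (huD : ∀ n, ∀ x ∈ D n, ‖u n x - 1‖ ≤ 1 / 4)
    (c : ℕ → ℂ) {ε : ℕ → ℝ} (hε : ∀ n, 0 < ε n) (hε1 : ∀ n, ε n ≤ 1) (hεanti : Antitone ε) :
    ∃ g : ℂ → ℂ, DifferentiableOn ℂ g W ∧ ∀ n, ∀ x ∈ D n, ‖g x - c n‖ < ε n := by
  let η : ℕ → ℝ := fun n => ε n * (1 / 2) ^ (n + 2)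
  have hη : ∀ n, 0 < η n := fun n => by have := hε n; positivity
  have step : ∀ (n : ℕ) (h : {h : ℂ → ℂ // DifferentiableOn ℂ h W}),
      ∃ h' : {h : ℂ → ℂ // DifferentiableOn ℂ h W},
        (∀ x ∈ C n, ‖h'.1 x - h.1 x‖ ≤ η n) ∧ ∀ x ∈ D n, ‖h'.1 x - c n‖ ≤ η n := by
    rintro n ⟨h, hh⟩
    obtain ⟨e, he, heC, heD⟩ := exists_differentiableOn_norm_le_and_norm_sub_le (hC n) (hCW n)
      (hD n) ((hDC n).trans (hCW _)) (hu n) ((differentiableOn_const (c n)).sub hh) (huC n) (huD n)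
      (hη n)
    refine ⟨⟨fun x => h x + e x, hh.add he⟩, fun x hx => ?_, fun x hx => ?_⟩
    · simpa using heC x hx
    · convert heD x hx using 2
      simp only [Pi.sub_apply]
      ring
  choose T hTC hTD using step
  let G : ℕ → {h : ℂ → ℂ // DifferentiableOn ℂ h W} :=
    fun n => Nat.rec ⟨fun _ => 0, differentiableOn_const 0⟩ T n
  have hsum : ∀ N x, ∑ n ∈ Finset.range N, ((G (n + 1)).1 x - (G n).1 x) = (G N).1 x := fun N x => by
    rw [Finset.sum_range_sub fun n => (G n).1 x]
    exact sub_zero _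
  let g : ℂ → ℂ := fun x => ∑' n, ((G (n + 1)).1 x - (G n).1 x)
  have hconv : ∀ m, TendstoUniformlyOn (fun N => (G N).1) g atTop (C m) := fun m => by
    have hsummable : Summable fun n : ℕ => (1 / 2 : ℝ) ^ n :=
      summable_geometric_of_lt_one (by norm_num) (by norm_num)
    convert tendstoUniformlyOn_tsum_nat_eventually (s := C m)
      (f := fun n x => (G (n + 1)).1 x - (G n).1 x) hsummable ?_ using 3 with N x
    · exact (hsum N x).symm
    · filter_upwards [eventually_ge_atTop m] with n hn x hx
      refine (hTC n (G n) x (hCmono hn hx)).trans ?_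
      calc η n ≤ 1 * (1 / 2) ^ (n + 2) := by simp only [η]; gcongr; exact hε1 n
        _ ≤ (1 / 2) ^ n := by
          rw [one_mul]
          exact pow_le_pow_of_le_one (by norm_num) (by norm_num) (by omega)
  refine ⟨g, ?_, fun k x hx => ?_⟩
  · have hloc : TendstoLocallyUniformlyOn (fun N => (G N).1) g atTop W := by
      rw [tendstoLocallyUniformlyOn_iff_forall_isCompact hW]
      intro s hsW hs
      obtain ⟨m, hm⟩ := hCexh s hsW hs
      exact (hconv m).mono hm
    exact hloc.differentiableOn (Eventually.of_forall fun N => (G N).2) hW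
  · have hbound : ∀ N, k + 1 ≤ N → ‖(G N).1 x - c k‖ ≤ ε k * (1 / 2 - (1 / 2) ^ (N + 1)) := by
      intro N hN
      induction N, hN using Nat.le_induction with
      | base =>
        refine (hTD k (G k) x hx).trans (mul_le_mul_of_nonneg_left ?_ (hε k).le)
        have hk : (1 / 2 : ℝ) ^ k ≤ 1 := pow_le_one₀ (by norm_num) (by norm_num)
        simp only [pow_succ]
        linarith
      | succ N hN ih =>
        have h1 : ‖(G (N + 1)).1 x - (G N).1 x‖ ≤ ε k * (1 / 2) ^ (N + 2) :=
          (hTC N (G N) x (hCmono hN (hDC k hx))).trans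
            (mul_le_mul_of_nonneg_right (hεanti (by omega)) (by positivity))
        calc ‖(G (N + 1)).1 x - c k‖
            ≤ ‖(G (N + 1)).1 x - (G N).1 x‖ + ‖(G N).1 x - c k‖ :=
              norm_sub_le_norm_sub_add_norm_sub _ _ _
          _ ≤ ε k * (1 / 2) ^ (N + 2) + ε k * (1 / 2 - (1 / 2) ^ (N + 1)) := add_le_add h1 ih
          _ = ε k * (1 / 2 - (1 / 2) ^ (N + 1 + 1)) := by ring
    have hlim : Tendsto (fun N => ‖(G N).1 x - c k‖) atTop (𝓝 ‖g x - c k‖) :=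
      (((hconv (k + 1)).tendsto_at (hDC k hx)).sub_const _).norm
    have hle : ‖g x - c k‖ ≤ ε k * (1 / 2) := by
      refine le_of_tendsto hlim ?_
      filter_upwards [eventually_ge_atTop (k + 1)] with N hN
      refine (hbound N hN).trans (mul_le_mul_of_nonneg_left ?_ (hε k).le)
      linarith [show (0 : ℝ) < (1 / 2) ^ (N + 1) by positivity]
    linarith [hε k]

theorem metrizableSpace_onePoint_complex : TopologicalSpace.MetrizableSpace (OnePoint ℂ) :=
  (onePointEquivSphereOfFinrankEq (ι := Fin 3) (V := ℂ)
    (by simp [Complex.finrank_real_complex])).isEmbedding.metrizableSpace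

theorem secondCountableTopology_onePoint_complex : SecondCountableTopology (OnePoint ℂ) :=
  (onePointEquivSphereOfFinrankEq (ι := Fin 3) (V := ℂ)
    (by simp [Complex.finrank_real_complex])).isEmbedding.secondCountableTopology

/-- **Wandering domains with prescribed ω-limit set, planar core.**
Let `W ⊊ ℂ` be a domain and `K` a nonempty closed subset of the boundary of `W` in the
one-point compactification `ℂ∞ = OnePoint ℂ`.  Then there exist a holomorphic
`g : W → ℂ`, points `z k ∈ W` and radii `r k > 0` with pairwise disjoint closed disks
`cl B(z k, r k) ⊆ W`, `g(cl B(z k, r k)) ⊆ B(z (k+1), r (k+1))`, `r k → 0`, and the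
accumulation set of `(z k)` in `ℂ∞` equals `K`. -/
theorem wandering_orbit_of_disks_plane
    (W : Set ℂ) (hWopen : IsOpen W) (hWconn : IsConnected W) (hWne : W ≠ Set.univ)
    (K : Set (OnePoint ℂ)) (hKne : K.Nonempty) (hKclosed : IsClosed K)
    (hKbdry : K ⊆ closure ((fun w : ℂ => (w : OnePoint ℂ)) '' W) \
        ((fun w : ℂ => (w : OnePoint ℂ)) '' W)) :
    ∃ (g : ℂ → ℂ) (z : ℕ → ℂ) (r : ℕ → ℝ),
      DifferentiableOn ℂ g W ∧
      (∀ k, 0 < r k) ∧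
      (∀ k, Metric.closedBall (z k) (r k) ⊆ W) ∧
      (∀ k l, k ≠ l →
        Disjoint (Metric.closedBall (z k) (r k)) (Metric.closedBall (z l) (r l))) ∧
      (∀ k, g '' Metric.closedBall (z k) (r k) ⊆ Metric.ball (z (k + 1)) (r (k + 1))) ∧
      Filter.Tendsto r Filter.atTop (nhds 0) ∧
      {w : OnePoint ℂ | ∃ k : ℕ → ℕ, StrictMono k ∧
          Filter.Tendsto (fun j => ((z (k j) : ℂ) : OnePoint ℂ))
            Filter.atTop (nhds w)} = K := by
  have := metrizableSpace_onePoint_complex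
  have := secondCountableTopology_onePoint_complex
  let := TopologicalSpace.metrizableSpaceMetric (OnePoint ℂ)
  obtain ⟨p, hpK, hp⟩ := hKclosed.exists_seq_setOf_subseq_limits_eq hKne
  obtain ⟨C, z, r, u, hC, hCW, hCmono, hCexh, hBC, hzU, hr, hrn, hranti, hu, huC, huB⟩ :=
    exists_seq_closedBall_separated hWopen (fun n => hKbdry (hpK n))
      (fun n : ℕ => ball_mem_nhds (p n) (show (0 : ℝ) < 1 / (n + 1) by positivity))
  obtain ⟨g, hg, hgB⟩ := exists_differentiableOn_norm_sub_lt hWopen hC hCW hCmono hCexh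
    (fun n => isCompact_closedBall (z n) (r n)) hBC hu huC huB (fun n => z (n + 1))
    (ε := fun n => r (n + 1)) (fun n => hr (n + 1))
    (fun n => (hrn (n + 1)).trans (div_le_one_of_le₀ (by push_cast; linarith) (by positivity)))
    (fun m n hmn => hranti (by omega))
  have hdisj : ∀ k l, k < l → Disjoint (closedBall (z k) (r k)) (closedBall (z l) (r l)) := by
    intro k l hkl
    refine Set.disjoint_left.2 fun x hxk hxl => ?_
    have h0 := huC l x (hCmono (Nat.succ_le_of_lt hkl) (hBC k hxk))
    have h1 := huB l x hxl
    have h2 := norm_sub_norm_le (1 : ℂ) (u l x)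
    rw [norm_sub_rev, norm_one] at h2
    linarith
  refine ⟨g, z, r, hg, hr, fun k => (hBC k).trans (hCW _), fun k l hkl => ?_, fun k => ?_, ?_,
    hp (fun n => (z n : OnePoint ℂ)) ?_⟩
  · rcases hkl.lt_or_gt with h | h
    · exact hdisj k l h
    · exact (hdisj l k h).symm
  · rintro _ ⟨x, hx, rfl⟩
    exact mem_ball_iff_norm.2 (hgB k x hx)
  · exact squeeze_zero (fun n => (hr n).le) hrn tendsto_one_div_add_atTop_nhds_zero_nat
  · exact squeeze_zero (fun n => dist_nonneg) (fun n => (mem_ball.1 (hzU n)).le)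
      tendsto_one_div_add_atTop_nhds_zero_nat
end

section
/- Let U ⊆ ℂ be a bounded domain and let f be holomorphic on U with f(U) ⊆ U. Let z ∈ U and suppose that dist(f^n(z), ∂U) → 0 as n → ∞. Let K be the set of accumulation points of the sequence (f^n(z)). Then there exists an injective, infinitely differentiable curve γ : [0,∞) → U whose accumulation set (the set of limits of γ(t_n) along sequences t_n → ∞) is exactly K. -/
open Set Filter Topology Metric

/-- An open convex set, slit along the ray from one of its points, is connected. -/
lemma Convex.isPreconnected_inter_slit {N : Set ℂ} (hN : Convex ℝ N) (hNo : IsOpen N) {c u : ℂ}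
    (hc : c ∈ N) (hu : u ≠ 0) : IsPreconnected (N ∩ {x | (x - c) / u ∈ Complex.slitPlane}) := by
  obtain ⟨ε, hε, hεN⟩ : ∃ ε : ℝ, 0 < ε ∧ c + ε * u ∈ N := by
    have h : Tendsto (fun ε : ℝ => c + ε * u) (𝓝[>] 0) (𝓝 c) := by
      have : Continuous fun ε : ℝ => c + ε * u := by fun_prop
      simpa using (this.tendsto 0).mono_left nhdsWithin_le_nhds
    obtain ⟨ε, h1, h2⟩ :=
      ((h.eventually (hNo.mem_nhds hc)).and self_mem_nhdsWithin).exists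
    exact ⟨ε, h2, h1⟩
  have hmem : c + ε * u ∈ N ∩ {x | (x - c) / u ∈ Complex.slitPlane} := by
    refine ⟨hεN, ?_⟩
    simp only [mem_ofPred_eq, add_sub_cancel_left, mul_div_assoc, div_self hu, mul_one]
    exact Complex.ofReal_mem_slitPlane.2 hε
  refine (StarConvex.isPathConnected (a := c + ε * u) ?_ hmem).isConnected.isPreconnected
  refine (hN hεN).inter ?_
  intro x hx a b ha hb hab
  have := Complex.starConvex_ofReal_slitPlane hε hx ha hb hab
  simp only [mem_ofPred_eq, Complex.real_smul] at this ⊢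
  convert this using 1
  have hab' : (a : ℂ) + b = 1 := by exact_mod_cast hab
  field_simp
  linear_combination c * hab'

/-- Removing `L` from a connected set does not disconnect it if removing `L` from some open
neighbourhood of `L` does not. -/
lemma IsPreconnected.sdiff_of_nhd {D L O : Set ℂ} (hD : IsPreconnected D) (hDL : IsOpen (D \ L))
    (hO : IsOpen O) (hLO : D ∩ L ⊆ O) (hOD : O ⊆ D) (hne : O.Nonempty)
    (hOL : IsPreconnected (O \ L)) : IsPreconnected (D \ L) := by
  have key : ∀ u v : Set ℂ, IsOpen u → IsOpen v → D \ L ⊆ u ∪ v → D \ L ∩ (u ∩ v) = ∅ →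
      O \ L ⊆ u → D \ L ⊆ u := by
    intro u v hu hv huv hdis hOu
    have hsub := (isPreconnected_iff_subset_of_disjoint.1 hD) ((u ∩ (D \ L)) ∪ O) (v ∩ (D \ L))
      ((hu.inter hDL).union hO) (hv.inter hDL) ?_ ?_
    · rcases hsub with h | h
      · intro x hx
        rcases h hx.1 with h' | h'
        · exact h'.1
        · exact hOu ⟨h', hx.2⟩
      · obtain ⟨x, hx⟩ := hne
        have hxv := h (hOD hx)
        intro y hy
        by_contra
        have : x ∈ D \ L ∩ (u ∩ v) := ⟨hxv.2, hOu ⟨hx, hxv.2.2⟩, hxv.1⟩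
        simp [hdis] at this
    · intro x hx
      by_cases hxL : x ∈ L
      · exact Or.inl (Or.inr (hLO ⟨hx, hxL⟩))
      · rcases huv ⟨hx, hxL⟩ with h | h
        · exact Or.inl (Or.inl ⟨h, hx, hxL⟩)
        · exact Or.inr ⟨h, hx, hxL⟩
    · rw [eq_empty_iff_forall_notMem] at hdis ⊢
      rintro x ⟨_, h1, h2⟩
      refine hdis x ⟨h2.2, ?_, h2.1⟩
      rcases h1 with h | h
      · exact h.1
      · exact hOu ⟨h, h2.2.2⟩
  rw [isPreconnected_iff_subset_of_disjoint]
  intro u v hu hv huv hdis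
  rcases (isPreconnected_iff_subset_of_disjoint.1 hOL) u v hu hv
    ((sdiff_subset_sdiff_left hOD).trans huv)
    (subset_empty_iff.1 ((inter_subset_inter_left _ (sdiff_subset_sdiff_left hOD)).trans hdis.le))
    with h | h
  · exact Or.inl (key u v hu hv huv hdis h)
  · exact Or.inr (key v u hv hu (by rwa [union_comm]) (by rwa [inter_comm v u]) h)

lemma IsPreconnected.sdiff_singleton_of_isOpen {D : Set ℂ} (hD : IsPreconnected D) (hDo : IsOpen D)
    {a : ℂ} (ha : a ∈ D) : IsPreconnected (D \ {a}) := by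
  obtain ⟨r, hr, hrD⟩ := Metric.isOpen_iff.1 hDo a ha
  refine hD.sdiff_of_nhd (hDo.sdiff isClosed_singleton) isOpen_ball (O := ball a r) ?_ hrD
    ⟨a, mem_ball_self hr⟩ ?_
  · rintro x ⟨_, rfl⟩
    exact mem_ball_self hr
  · have h1 := (convex_ball a r).isPreconnected_inter_slit isOpen_ball (mem_ball_self hr)
      (one_ne_zero (α := ℂ))
    have h2 := (convex_ball a r).isPreconnected_inter_slit isOpen_ball (mem_ball_self hr)
      (neg_ne_zero.2 (one_ne_zero (α := ℂ)))
    have hI : a + (r / 2 : ℝ) * Complex.I ∈ ball a r := by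
      simp [abs_of_pos hr, hr]
    have h := h1.union' ⟨a + (r / 2 : ℝ) * Complex.I,
      by exact ⟨⟨hI, by simp [Complex.mem_slitPlane_iff, hr.ne']⟩,
        ⟨hI, by simp [Complex.mem_slitPlane_iff, div_neg, hr.ne']⟩⟩⟩ h2
    · convert h using 1
      ext x
      simp only [Set.mem_sdiff, mem_singleton_iff, mem_union, mem_inter_iff, mem_ofPred_eq,
        ← and_or_left, div_one, div_neg, Complex.mem_slitPlane_iff]
      refine and_congr_right fun _ => ?_
      rw [← sub_eq_zero, Complex.ext_iff]
      simp only [Complex.zero_re, Complex.zero_im, Complex.neg_re, Complex.neg_im]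
      constructor
      · intro h
        by_contra! h'
        exact h ⟨by linarith [h'.1.1, h'.2.1], h'.1.2⟩
      · rintro h ⟨h1, h2⟩
        simp [h1, h2] at h

lemma div_notMem_slitPlane_iff {x c u : ℂ} (hu : u ≠ 0) :
    (x - c) / u ∉ Complex.slitPlane ↔ ∃ s : ℝ, 0 ≤ s ∧ x = c - s * u := by
  rw [Complex.mem_slitPlane_iff]
  push Not
  constructor
  · rintro ⟨h1, h2⟩
    refine ⟨-((x - c) / u).re, by linarith, ?_⟩
    have : (((x - c) / u).re : ℂ) = (x - c) / u := Complex.ext (by simp) (by simp [h2])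
    rw [Complex.ofReal_neg, this]
    field_simp
    ring
  · rintro ⟨s, hs, rfl⟩
    have : (c - s * u - c) / u = ((-s : ℝ) : ℂ) := by
      push_cast
      field_simp
      ring
    rw [this]
    simpa using hs

lemma mem_segment_iff_sub_mul {b c x : ℂ} :
    x ∈ segment ℝ b c ↔ ∃ s : ℝ, 0 ≤ s ∧ s ≤ 1 ∧ x = c - s * (c - b) := by
  rw [segment_symm, segment_eq_image']
  constructor
  · rintro ⟨s, hs, rfl⟩
    exact ⟨s, hs.1, hs.2, by simp only [Complex.real_smul]; ring⟩
  · rintro ⟨s, h0, h1, rfl⟩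
    exact ⟨s, ⟨h0, h1⟩, by simp only [Complex.real_smul]; ring⟩

lemma isClosed_segment (b c : ℂ) : IsClosed (segment ℝ b c) := by
  rw [segment_eq_image_lineMap]
  exact (isCompact_Icc.image AffineMap.lineMap_continuous).isClosed

lemma isCompact_segment (b c : ℂ) : IsCompact (segment ℝ b c) := by
  rw [segment_eq_image_lineMap]
  exact isCompact_Icc.image AffineMap.lineMap_continuous

/-- A segment growing from outside does not disconnect an open connected set. -/
lemma IsPreconnected.sdiff_segment {D : Set ℂ} (hD : IsPreconnected D) (hDo : IsOpen D) {b c : ℂ}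
    (hbc : b ≠ c) (hb : b ∉ D) (hL : segment ℝ b c \ {b} ⊆ D) :
    IsPreconnected (D \ segment ℝ b c) := by
  have hu : c - b ≠ 0 := sub_ne_zero.2 hbc.symm
  set T : Set (Set ℂ) := {N | Convex ℝ N ∧ IsOpen N ∧ c ∈ N ∧ N ⊆ D} with hT
  have hslit : ∀ N ∈ T, N \ segment ℝ b c = N ∩ {x | (x - c) / (c - b) ∈ Complex.slitPlane} := by
    rintro N ⟨hNc, -, hcN, hND⟩
    ext x
    simp only [Set.mem_sdiff, mem_inter_iff, mem_ofPred_eq]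
    refine and_congr_right fun hx => ?_
    rw [not_iff_comm, div_notMem_slitPlane_iff hu, mem_segment_iff_sub_mul]
    constructor
    · rintro ⟨s, hs, hxs⟩
      refine ⟨s, hs, ?_, hxs⟩
      by_contra! h1
      refine hb (hND (hNc.segment_subset hcN hx ?_))
      rw [segment_symm, mem_segment_iff_sub_mul]
      refine ⟨1 / s, by positivity, by rw [div_le_one (by linarith)]; exact h1.le, ?_⟩
      have : (s : ℂ) ≠ 0 := by
        exact_mod_cast (by linarith : s ≠ 0)
      rw [hxs]
      push_cast
      field_simp
      ring
    · rintro ⟨s, hs, -, hxs⟩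
      exact ⟨s, hs, hxs⟩
  have hcD : c ∈ D := hL ⟨right_mem_segment _ _ _, hbc.symm⟩
  obtain ⟨r, hr, hrD⟩ := Metric.isOpen_iff.1 hDo c hcD
  have hcT : ball c r ∈ T := ⟨convex_ball _ _, isOpen_ball, mem_ball_self hr, hrD⟩
  refine hD.sdiff_of_nhd (hDo.sdiff (isClosed_segment _ _)) (O := ⋃ N ∈ T, N)
    (isOpen_biUnion fun N hN => hN.2.1) ?_ (iUnion₂_subset fun N hN => hN.2.2.2)
    ⟨c, mem_biUnion hcT (mem_ball_self hr)⟩ ?_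
  · rintro p ⟨hpD, hp⟩
    have hsub : segment ℝ p c ⊆ D := by
      intro x hx
      refine hL ⟨(convex_segment b c).segment_subset hp (right_mem_segment _ _ _) hx, ?_⟩
      rintro rfl
      obtain ⟨s, hs0, hs1, hps⟩ := mem_segment_iff_sub_mul.1 hp
      obtain ⟨s', hs0', hs1', hxs⟩ := mem_segment_iff_sub_mul.1 hx
      have h1 : (c - x) * (1 - s * s') = 0 := by rw [hps] at hxs; linear_combination -hxs
      have h2 : (1 - s * s' : ℂ) = 0 := (mul_eq_zero.1 h1).resolve_left hu
      have h3 : 1 - s * s' = 0 := by exact_mod_cast h2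
      have h4 : s = 1 := by nlinarith
      rw [h4] at hps
      simp only [Complex.ofReal_one, one_mul, sub_sub_cancel] at hps
      exact hb (hps ▸ hpD)
    obtain ⟨δ, hδ, hδD⟩ := (isCompact_segment p c).exists_thickening_subset_open hDo hsub
    have hself := self_subset_thickening hδ (segment ℝ p c)
    exact mem_biUnion (x := thickening δ (segment ℝ p c))
      ⟨(convex_segment p c).thickening δ, isOpen_thickening, hself (right_mem_segment _ _ _), hδD⟩
      (hself (left_mem_segment _ _ _))
  · simp only [iUnion_sdiff]
    have hpre : ∀ N ∈ T, IsPreconnected (N \ segment ℝ b c) := fun N hN => by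
      rw [hslit N hN]
      exact hN.1.isPreconnected_inter_slit hN.2.1 hN.2.2.1 hu
    refine IsPreconnected.biUnion_of_reflTransGen hpre fun N hN M hM =>
      Relation.ReflTransGen.single ⟨?_, hN⟩
    have hNM : c ∈ N ∩ M := ⟨hN.2.2.1, hM.2.2.1⟩
    rw [hslit N hN, hslit M hM]
    have h : Tendsto (fun ε : ℝ => c + ε * (c - b)) (𝓝[>] 0) (𝓝 c) := by
      have : Continuous fun ε : ℝ => c + ε * (c - b) := by fun_prop
      simpa using (this.tendsto 0).mono_left nhdsWithin_le_nhds
    obtain ⟨ε, h1, h2⟩ :=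
      ((h.eventually ((hN.2.1.inter hM.2.1).mem_nhds hNM)).and self_mem_nhdsWithin).exists
    have h3 : (c + ε * (c - b) - c) / (c - b) ∈ Complex.slitPlane := by
      rw [add_sub_cancel_left, mul_div_assoc, div_self hu, mul_one]
      exact Complex.ofReal_mem_slitPlane.2 h2
    exact ⟨_, ⟨h1.1, h3⟩, h1.2, h3⟩

lemma eq_of_inter_eq_singleton {α : Type*} {s t : Set α} {b x : α} (h : s ∩ t = {b}) (hs : x ∈ s)
    (ht : x ∈ t) : x = b :=
  mem_singleton_iff.1 (h ▸ ⟨hs, ht⟩)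

/-- `PolyArc a S b` says that `S` is the trace of an injective polygonal path from `a` to `b`. -/
inductive PolyArc (a : ℂ) : Set ℂ → ℂ → Prop
  | nil : PolyArc a {a} a
  | snoc {S : Set ℂ} {b c : ℂ} : PolyArc a S b → b ≠ c → segment ℝ b c ∩ S = {b} →
      PolyArc a (S ∪ segment ℝ b c) c

namespace PolyArc

variable {a b c : ℂ} {S S' C D : Set ℂ}

lemma isCompact (h : PolyArc a S b) : IsCompact S := by
  induction h with
  | nil => exact isCompact_singleton
  | snoc _ _ _ ih => exact ih.union (isCompact_segment _ _)

lemma left_mem (h : PolyArc a S b) : a ∈ S := by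
  induction h with
  | nil => exact mem_singleton _
  | snoc _ _ _ ih => exact Or.inl ih

lemma right_mem (h : PolyArc a S b) : b ∈ S := by
  cases h with
  | nil => exact mem_singleton _
  | snoc _ _ _ => exact Or.inr (right_mem_segment _ _ _)

lemma trans (h : PolyArc a S b) (h' : PolyArc b S' c) (hSS : S ∩ S' = {b}) :
    PolyArc a (S ∪ S') c := by
  induction h' with
  | nil => rwa [union_eq_self_of_subset_right (singleton_subset_iff.2 h.right_mem)]
  | @snoc S' d c hd hdc hS' ih =>
    have hsub : S ∩ S' = {b} := by
      refine Subset.antisymm ?_ (singleton_subset_iff.2 ⟨h.right_mem, hd.left_mem⟩)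
      rw [← hSS]
      gcongr
      exact subset_union_left
    rw [← union_assoc]
    refine (ih hsub).snoc hdc ?_
    rw [inter_union_distrib_left, hS']
    refine union_eq_self_of_subset_left ?_
    rintro x ⟨hx1, hx2⟩
    have hxb : x = b := by
      have : x ∈ S ∩ (S' ∪ segment ℝ d c) := ⟨hx2, Or.inr hx1⟩
      rwa [hSS] at this
    rw [← hS']
    exact ⟨hx1, hxb ▸ hd.left_mem⟩

lemma isPreconnected_sdiff (h : PolyArc a S b) (hD : IsPreconnected D) (hDo : IsOpen D)
    (ha : a ∉ D) (hSD : S \ {a} ⊆ D) : IsPreconnected (D \ S) := by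
  induction h with
  | nil => rwa [sdiff_singleton_eq_self ha]
  | @snoc S b c hS hbc hbS ih =>
    rw [← sdiff_sdiff]
    refine (ih ((sdiff_subset_sdiff_left subset_union_left).trans hSD)).sdiff_segment
      (hDo.sdiff hS.isCompact.isClosed) hbc (fun h => h.2 hS.right_mem) ?_
    rintro x ⟨hx, hxb⟩
    have hxS : x ∉ S := fun hxS => hxb (eq_of_inter_eq_singleton hbS hx hxS)
    refine ⟨hSD ⟨Or.inr hx, ?_⟩, hxS⟩
    rintro rfl
    exact hxS hS.left_mem

/-- Near its endpoint a polygonal arc is a straight segment. -/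
lemma exists_direction (h : PolyArc a S b) (hab : a ≠ b) :
    ∃ u : ℂ, u ≠ 0 ∧ ∃ r > 0, ∀ x ∈ ball b r, x ∉ S ↔ (x - b) / u ∈ Complex.slitPlane := by
  cases h with
  | nil => exact absurd rfl hab
  | @snoc S' d c hd hdc hS' =>
    have hu : b - d ≠ 0 := sub_ne_zero.2 hdc.symm
    have hbS : b ∉ S' := fun hb =>
      hdc (eq_of_inter_eq_singleton hS' (right_mem_segment _ _ _) hb).symm
    obtain ⟨r, hr, hrS⟩ := Metric.isOpen_iff.1 hd.isCompact.isClosed.isOpen_compl b hbS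
    refine ⟨b - d, hu, min r (dist d b), lt_min hr (dist_pos.2 hdc), fun x hx => ?_⟩
    rw [not_iff_comm, div_notMem_slitPlane_iff hu, mem_union, mem_segment_iff_sub_mul]
    have hx1 : x ∉ S' := hrS (ball_subset_ball (min_le_left _ _) hx)
    constructor
    · rintro ⟨s, hs, hxs⟩
      refine Or.inr ⟨s, hs, ?_, hxs⟩
      have hx2 := (mem_ball.1 hx).trans_le (min_le_right _ _)
      rw [hxs, dist_eq_norm, dist_eq_norm, sub_sub_cancel_left, norm_neg, norm_mul,
        Complex.norm_real, Real.norm_of_nonneg hs, norm_sub_rev d b] at hx2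
      have := norm_pos_iff.2 hu
      by_contra! h1
      nlinarith
    · rintro (h | ⟨s, hs, -, hxs⟩)
      · exact absurd h hx1
      · exact ⟨s, hs, hxs⟩

end PolyArc

/-- A segment issuing from outside a closed set first meets it at some point. -/
lemma exists_first_mem_segment {b c : ℂ} {C : Set ℂ} (hC : IsClosed C)
    (hne : (segment ℝ b c ∩ C).Nonempty) :
    ∃ p ∈ segment ℝ b c, segment ℝ b p ∩ C = {p} := by
  obtain ⟨p, hp, hmin⟩ := ((isCompact_segment b c).inter_right hC).exists_isMinOn hne
    (f := fun x => dist b x) (by fun_prop)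
  refine ⟨p, hp.1, Subset.antisymm ?_ (singleton_subset_iff.2 ⟨right_mem_segment _ _ _, hp.2⟩)⟩
  rintro x ⟨hx, hxC⟩
  have h1 : dist b p ≤ dist b x :=
    hmin ⟨(convex_segment b c).segment_subset (left_mem_segment _ _ _) hp.1 hx, hxC⟩
  have h2 := dist_add_dist_of_mem_segment hx
  exact dist_le_zero.1 (by linarith)

namespace PolyArc

variable {a b c : ℂ} {S S' C D : Set ℂ}

/-- A polygonal arc can be stopped when it first meets a closed set. -/
lemma exists_truncate (h : PolyArc a S b) (hC : IsClosed C) (ha : a ∉ C) (hne : (S ∩ C).Nonempty) :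
    ∃ S' b', PolyArc a S' b' ∧ S' ⊆ S ∧ S' ∩ C = {b'} := by
  induction h with
  | nil =>
    obtain ⟨x, rfl, hx⟩ := hne
    exact absurd hx ha
  | @snoc S b c hS hbc hbS ih =>
    by_cases hSC : (S ∩ C).Nonempty
    · obtain ⟨S', b', h1, h2, h3⟩ := ih hSC
      exact ⟨S', b', h1, h2.trans subset_union_left, h3⟩
    · have hSC' : S ∩ C = ∅ := not_nonempty_iff_eq_empty.1 hSC
      rw [union_inter_distrib_right, hSC', empty_union] at hne
      obtain ⟨p, hp, hpC⟩ := exists_first_mem_segment hC hne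
      have hsub := (convex_segment b c).segment_subset (left_mem_segment _ _ _) hp
      have hpmem : p ∈ segment ℝ b p ∩ C := hpC ▸ mem_singleton p
      refine ⟨S ∪ segment ℝ b p, p, hS.snoc ?_ ?_, union_subset_union_right _ hsub, ?_⟩
      · rintro rfl
        exact hSC ⟨b, hS.right_mem, hpmem.2⟩
      · refine Subset.antisymm ?_ (singleton_subset_iff.2 ⟨left_mem_segment _ _ _, hS.right_mem⟩)
        rintro x ⟨hx, hxS⟩
        exact eq_of_inter_eq_singleton hbS (hsub hx) hxS
      · rw [union_inter_distrib_right, hSC', empty_union, hpC]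

/-- A polygonal arc meeting a closed convex set can be rerouted to end at any point of it. -/
lemma exists_reroute (h : PolyArc a S b) (hC : IsClosed C) (hconv : Convex ℝ C) (ha : a ∉ C)
    (hne : (S ∩ C).Nonempty) {y : ℂ} (hy : y ∈ C) :
    ∃ S', PolyArc a S' y ∧ S' ⊆ S ∪ C := by
  obtain ⟨S', b', h1, h2, h3⟩ := h.exists_truncate hC ha hne
  have hb' : b' ∈ S' ∩ C := h3 ▸ mem_singleton b'
  have hsub : segment ℝ b' y ⊆ C := hconv.segment_subset hb'.2 hy
  by_cases hby : b' = y
  · subst hby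
    exact ⟨S', h1, h2.trans subset_union_left⟩
  · refine ⟨_, h1.snoc hby ?_, union_subset_union h2 hsub⟩
    refine Subset.antisymm ?_ (singleton_subset_iff.2 ⟨left_mem_segment _ _ _, hb'.1⟩)
    rw [← h3]
    exact fun x hx => ⟨hx.2, hsub hx.1⟩

/-- From an accessible boundary point one can reach every point of an open connected set by
a polygonal arc. -/
lemma exists_of_accessible (hD : IsPreconnected D) (hDo : IsOpen D) (ha : a ∉ D)
    (hacc : ∃ p ≠ a, segment ℝ a p \ {a} ⊆ D) {t : ℂ} (ht : t ∈ D) :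
    ∃ S, PolyArc a S t ∧ S \ {a} ⊆ D := by
  set R : Set ℂ := {t ∈ D | ∃ S, PolyArc a S t ∧ S \ {a} ⊆ D} with hR
  have hstep : ∀ x : ℂ, ∀ r : ℝ, closedBall x r ⊆ D → (closedBall x r ∩ R).Nonempty →
      closedBall x r ⊆ R := by
    rintro x r hxr ⟨w, hwx, hwD, S, hS, hSD⟩ y hy
    obtain ⟨S', hS', hsub⟩ := hS.exists_reroute isClosed_closedBall (convex_closedBall x r)
      (fun h => ha (hxr h)) ⟨w, hS.right_mem, hwx⟩ hy
    refine ⟨hxr hy, S', hS', ?_⟩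
    rintro z ⟨hz, hza⟩
    rcases hsub hz with h | h
    · exact hSD ⟨h, hza⟩
    · exact hxr h
  have hball : ∀ x ∈ D, ∃ r > 0, closedBall x r ⊆ D := fun x hx =>
    Metric.nhds_basis_closedBall.mem_iff.1 (hDo.mem_nhds hx)
  have hRo : IsOpen R := by
    refine Metric.isOpen_iff.2 fun x hx => ?_
    obtain ⟨r, hr, hrD⟩ := hball x hx.1
    exact ⟨r, hr, ball_subset_closedBall.trans
      (hstep x r hrD ⟨x, mem_closedBall_self hr.le, hx⟩)⟩
  obtain ⟨p, hpa, hp⟩ := hacc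
  have hpR : p ∈ R := by
    refine ⟨hp ⟨right_mem_segment _ _ _, hpa⟩, {a} ∪ segment ℝ a p,
      PolyArc.nil.snoc hpa.symm ?_, ?_⟩
    · exact inter_eq_self_of_subset_right (singleton_subset_iff.2 (left_mem_segment _ _ _))
    · rintro x ⟨h | h, hx⟩
      · exact absurd h hx
      · exact hp ⟨h, hx⟩
  refine (hD.subset_of_closure_inter_subset hRo ⟨p, hpR.1, hpR⟩ ?_ ht).2
  rintro x ⟨hx, hxD⟩
  obtain ⟨r, hr, hrD⟩ := hball x hxD
  obtain ⟨w, hwR, hw⟩ := Metric.mem_closure_iff.1 hx r hr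
  exact hstep x r hrD ⟨w, by rw [mem_closedBall, dist_comm]; exact hw.le, hwR⟩
    (mem_closedBall_self hr.le)

end PolyArc

lemma exists_segment_subset_ball_slit (b : ℂ) {u : ℂ} (hu : u ≠ 0) {r : ℝ} (hr : 0 < r) :
    ∃ p ≠ b, segment ℝ b p \ {b} ⊆ ball b r ∩ {x | (x - b) / u ∈ Complex.slitPlane} := by
  have hun : 0 < ‖u‖ := norm_pos_iff.2 hu
  set s : ℝ := r / (2 * ‖u‖) with hs
  have hs0 : 0 < s := by positivity
  have hsu : s * ‖u‖ = r / 2 := by rw [hs]; field_simp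
  have hsC : (s : ℂ) ≠ 0 := by exact_mod_cast hs0.ne'
  refine ⟨b + s * u, by simp [hu, hs0.ne'], ?_⟩
  rintro x ⟨hx, hxb⟩
  have hxball : x ∈ ball b r := by
    refine (convex_ball b r).segment_subset (mem_ball_self hr) ?_ hx
    rw [mem_ball, dist_eq_norm, add_sub_cancel_left, norm_mul, Complex.norm_real,
      Real.norm_of_nonneg hs0.le, hsu]
    linarith
  refine ⟨hxball, ?_⟩
  rw [segment_eq_image'] at hx
  obtain ⟨θ, hθ, rfl⟩ := hx
  have hθ0 : 0 < θ := by
    refine lt_of_le_of_ne hθ.1 ?_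
    rintro rfl
    simp at hxb
  have : (b + θ • (b + s * u - b) - b) / u = ((θ * s : ℝ) : ℂ) := by
    rw [Complex.real_smul]
    push_cast
    field_simp
    ring
  rw [mem_ofPred_eq]
  simp only [this]
  exact Complex.ofReal_mem_slitPlane.2 (by positivity)

/-- An injective smooth parametrization of `S` by `[0, 1]` from `a` to `b`, constant on both sides
of the interval. -/
structure IsFlatArc (g : ℝ → ℂ) (S : Set ℂ) (a b : ℂ) : Prop where
  contDiff : ContDiff ℝ (⊤ : ℕ∞) g
  of_nonpos : ∀ t ≤ 0, g t = a
  of_one_le : ∀ t, 1 ≤ t → g t = b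
  injOn : InjOn g (Icc 0 1)
  image_eq : g '' Icc 0 1 = S

lemma Real.smoothTransition_injOn : InjOn Real.smoothTransition (Icc 0 1) := by
  have key : ∀ s t : ℝ, 0 ≤ s → s < t → t ≤ 1 →
      Real.smoothTransition s < Real.smoothTransition t := by
    intro s t hs hst ht
    rcases hs.eq_or_lt with rfl | hs
    · rw [Real.smoothTransition.zero]
      exact Real.smoothTransition.pos_of_pos hst
    rcases ht.eq_or_lt with rfl | ht
    · rw [Real.smoothTransition.one]
      exact Real.smoothTransition.lt_one_of_lt_one hst
    have mono : ∀ x y : ℝ, 0 < x → x < y → expNegInvGlue x < expNegInvGlue y := by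
      intro x y hx hxy
      simp only [expNegInvGlue, not_le.2 hx, not_le.2 (hx.trans hxy), if_false]
      gcongr
    have h1 := mono s t hs hst
    have h2 := mono (1 - t) (1 - s) (by linarith) (by linarith)
    have h3 := expNegInvGlue.pos_of_pos hs
    have h4 := expNegInvGlue.pos_of_pos (show 0 < 1 - t by linarith)
    rw [Real.smoothTransition, Real.smoothTransition, div_lt_div_iff₀ (by linarith) (by linarith)]
    nlinarith [mul_lt_mul'' h1 h2 h3.le h4.le]
  intro s hs t ht h
  rcases lt_trichotomy s t with hst | hst | hst
  · exact absurd h (key s t hs.1 hst ht.2).ne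
  · exact hst
  · exact absurd h (key t s ht.1 hst hs.2).ne'

lemma IsFlatArc.segment {a b : ℂ} (hab : a ≠ b) :
    IsFlatArc (fun t => a + Real.smoothTransition t • (b - a)) (segment ℝ a b) a b where
  contDiff := contDiff_const.add (Real.smoothTransition.contDiff.smul contDiff_const)
  of_nonpos t ht := by simp [Real.smoothTransition.zero_of_nonpos ht]
  of_one_le t ht := by simp [Real.smoothTransition.one_of_one_le ht]
  injOn s hs t ht h := by
    refine Real.smoothTransition_injOn hs ht ?_
    have h' := add_left_cancel h
    exact smul_left_injective ℝ (sub_ne_zero.2 hab.symm) h'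
  image_eq := by
    have himg : Real.smoothTransition '' Icc 0 1 = Icc 0 1 := by
      refine Subset.antisymm ?_ ?_
      · rintro _ ⟨t, -, rfl⟩
        exact ⟨Real.smoothTransition.nonneg t, Real.smoothTransition.le_one t⟩
      · have := intermediate_value_Icc zero_le_one
          (Real.smoothTransition.continuous.continuousOn (s := Icc (0 : ℝ) 1))
        rwa [Real.smoothTransition.zero, Real.smoothTransition.one] at this
    rw [segment_eq_image']
    conv_rhs => rw [← himg, image_image]

lemma IsFlatArc.trans {g h : ℝ → ℂ} {S T : Set ℂ} {a b c : ℂ} (hg : IsFlatArc g S a b)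
    (hh : IsFlatArc h T b c) (hST : T ∩ S = {b}) :
    IsFlatArc (fun t => g (2 * t) + h (2 * t - 1) - b) (S ∪ T) a c := by
  have h1 : ∀ t : ℝ, t ≤ 1 / 2 → g (2 * t) + h (2 * t - 1) - b = g (2 * t) := fun t ht => by
    rw [hh.of_nonpos _ (by linarith)]; ring
  have h2 : ∀ t : ℝ, 1 / 2 ≤ t → g (2 * t) + h (2 * t - 1) - b = h (2 * t - 1) := fun t ht => by
    rw [hg.of_one_le _ (by linarith)]; ring
  have hmix : ∀ s t : ℝ, s ∈ Icc (0 : ℝ) 1 → t ∈ Icc (0 : ℝ) 1 → s ≤ 1 / 2 → 1 / 2 ≤ t →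
      g (2 * s) = h (2 * t - 1) → s = t := by
    intro s t hs ht hs2 ht2 heq
    have hgS : g (2 * s) ∈ S := hg.image_eq ▸
      mem_image_of_mem g (⟨by linarith [hs.1], by linarith⟩ : 2 * s ∈ Icc (0 : ℝ) 1)
    have hhT : h (2 * t - 1) ∈ T := hh.image_eq ▸
      mem_image_of_mem h (⟨by linarith, by linarith [ht.2]⟩ : 2 * t - 1 ∈ Icc (0 : ℝ) 1)
    have hb : h (2 * t - 1) = b := eq_of_inter_eq_singleton hST hhT (heq ▸ hgS)
    have e1 := hg.injOn (x₁ := 2 * s) ⟨by linarith [hs.1], by linarith⟩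
      (right_mem_Icc.2 zero_le_one) (by rw [heq, hb, hg.of_one_le 1 le_rfl])
    have e2 := hh.injOn (x₁ := 2 * t - 1) ⟨by linarith, by linarith [ht.2]⟩
      (left_mem_Icc.2 zero_le_one) (by rw [hb, hh.of_nonpos 0 le_rfl])
    linarith
  constructor
  · have := hg.contDiff
    have := hh.contDiff
    fun_prop
  · intro t ht
    rw [h1 t (by linarith), hg.of_nonpos _ (by linarith)]
  · intro t ht
    rw [h2 t (by linarith), hh.of_one_le _ (by linarith)]
  · intro s hs t ht heq
    simp only at heq
    rcases le_total s (1 / 2) with hs2 | hs2 <;> rcases le_total t (1 / 2) with ht2 | ht2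
    · rw [h1 s hs2, h1 t ht2] at heq
      have := hg.injOn (x₁ := 2 * s) (x₂ := 2 * t) ⟨by linarith [hs.1], by linarith⟩
        ⟨by linarith [ht.1], by linarith⟩ heq
      linarith
    · rw [h1 s hs2, h2 t ht2] at heq
      exact hmix s t hs ht hs2 ht2 heq
    · rw [h2 s hs2, h1 t ht2] at heq
      exact (hmix t s ht hs ht2 hs2 heq.symm).symm
    · rw [h2 s hs2, h2 t ht2] at heq
      have := hh.injOn (x₁ := 2 * s - 1) (x₂ := 2 * t - 1) ⟨by linarith, by linarith [hs.2]⟩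
        ⟨by linarith, by linarith [ht.2]⟩ heq
      linarith
  · rw [← hg.image_eq, ← hh.image_eq]
    refine Subset.antisymm ?_ ?_
    · rintro _ ⟨t, ht, rfl⟩
      rcases le_total t (1 / 2) with ht2 | ht2
      · exact Or.inl ⟨2 * t, ⟨by linarith [ht.1], by linarith⟩, (h1 t ht2).symm⟩
      · exact Or.inr ⟨2 * t - 1, ⟨by linarith, by linarith [ht.2]⟩, (h2 t ht2).symm⟩
    · rintro _ (⟨t, ht, rfl⟩ | ⟨t, ht, rfl⟩)
      · refine ⟨t / 2, ⟨by linarith [ht.1], by linarith [ht.2]⟩, ?_⟩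
        simp only
        rw [h1 _ (by linarith [ht.2]), mul_div_cancel₀ _ two_ne_zero]
      · refine ⟨(t + 1) / 2, ⟨by linarith [ht.1], by linarith [ht.2]⟩, ?_⟩
        simp only
        rw [h2 _ (by linarith [ht.1]), mul_div_cancel₀ _ two_ne_zero, add_sub_cancel_right]

lemma PolyArc.exists_isFlatArc {a b : ℂ} {S : Set ℂ} (h : PolyArc a S b) (hab : a ≠ b) :
    ∃ g, IsFlatArc g S a b := by
  have key : (S = {a} ∧ b = a) ∨ ∃ g, IsFlatArc g S a b := by
    clear hab
    induction h with
    | nil => exact Or.inl ⟨rfl, rfl⟩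
    | @snoc S b c hS hbc hbS ih =>
      right
      rcases ih with ⟨rfl, rfl⟩ | ⟨g, hg⟩
      · rw [union_eq_self_of_subset_left (singleton_subset_iff.2 (left_mem_segment _ _ _))]
        exact ⟨_, IsFlatArc.segment hbc⟩
      · exact ⟨_, hg.trans (IsFlatArc.segment hbc) hbS⟩
  exact key.resolve_left fun h => hab h.2.symm

/-- Infinitely many consecutive flat arcs glue to an injective smooth curve. -/
lemma exists_contDiff_injOn_of_isFlatArc {g : ℕ → ℝ → ℂ} {S : ℕ → Set ℂ} {a : ℕ → ℂ}
    (hg : ∀ n, IsFlatArc (g n) (S n) (a n) (a (n + 1)))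
    (hS : ∀ m n, m < n → Disjoint (S m) (S n \ {a n})) :
    ∃ γ : ℝ → ℂ, ContDiff ℝ (⊤ : ℕ∞) γ ∧ InjOn γ (Ici 0) ∧
      ∀ n : ℕ, γ '' Icc (n : ℝ) (n + 1) = S n := by
  let G : ℕ → ℝ → ℂ := fun n =>
    Nat.rec (g 0) (fun n G t => G t + (g (n + 1) (t - (n + 1 : ℕ)) - a (n + 1))) n
  have hGs : ∀ n t, G (n + 1) t = G n t + (g (n + 1) (t - (n + 1 : ℕ)) - a (n + 1)) :=
    fun n t => rfl
  have hGdiff : ∀ n, ContDiff ℝ (⊤ : ℕ∞) (G n) := by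
    intro n
    induction n with
    | zero => exact (hg 0).contDiff
    | succ n ih =>
      have := (hg (n + 1)).contDiff
      have e : G (n + 1) = fun t => G n t + (g (n + 1) (t - (n + 1 : ℕ)) - a (n + 1)) := rfl
      rw [e]
      fun_prop
  have hGsucc : ∀ n : ℕ, ∀ t : ℝ, t ≤ n + 1 → G (n + 1) t = G n t := by
    intro n t ht
    rw [hGs, (hg (n + 1)).of_nonpos _ (by push_cast; linarith)]
    ring
  have hGstable : ∀ m n : ℕ, m ≤ n → ∀ t : ℝ, t ≤ m + 1 → G n t = G m t := by
    intro m n hmn t ht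
    induction n, hmn using Nat.le_induction with
    | base => rfl
    | succ n hmn ih =>
      have : (m : ℝ) ≤ n := by exact_mod_cast hmn
      rw [hGsucc n t (by linarith), ih]
  have hGeq : ∀ n : ℕ, ∀ t : ℝ, n ≤ t → G n t = g n (t - n) := by
    intro n
    induction n with
    | zero => intro t _; simp [G]
    | succ n ih =>
      intro t ht
      push_cast at ht
      rw [hGs, ih t (by linarith), (hg n).of_one_le _ (by linarith)]
      ring
  set γ : ℝ → ℂ := fun t => G ⌈t⌉₊ t with hγ
  have hγG : ∀ n : ℕ, ∀ t : ℝ, t ≤ n → γ t = G n t := fun n t ht =>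
    (hGstable _ _ (Nat.ceil_le.2 ht) t (by linarith [Nat.le_ceil t])).symm
  have hγg : ∀ n : ℕ, ∀ t ∈ Icc (n : ℝ) (n + 1), γ t = g n (t - n) := fun n t ht => by
    rw [hγG (n + 1) t (by push_cast; exact ht.2), hGsucc n t ht.2, hGeq n t ht.1]
  have himage : ∀ n : ℕ, γ '' Icc (n : ℝ) (n + 1) = S n := by
    intro n
    rw [← (hg n).image_eq]
    refine Subset.antisymm ?_ ?_
    · rintro _ ⟨t, ht, rfl⟩
      exact ⟨t - n, ⟨by linarith [ht.1], by linarith [ht.2]⟩, (hγg n t ht).symm⟩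
    · rintro _ ⟨t, ht, rfl⟩
      have ht' : t + n ∈ Icc (n : ℝ) (n + 1) := ⟨by linarith [ht.1], by linarith [ht.2]⟩
      exact ⟨t + n, ht', by rw [hγg n _ ht', add_sub_cancel_right]⟩
  have hmem : ∀ n : ℕ, ∀ t : ℝ, n < t → t ≤ n + 1 → γ t ∈ S n \ {a n} := by
    intro n t h1 h2
    refine ⟨himage n ▸ mem_image_of_mem γ ⟨h1.le, h2⟩, fun h => ?_⟩
    rw [mem_singleton_iff, hγg n t ⟨h1.le, h2⟩, ← (hg n).of_nonpos 0 le_rfl] at h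
    have := (hg n).injOn (x₁ := t - n) ⟨by linarith, by linarith⟩
      (left_mem_Icc.2 zero_le_one) h
    linarith
  have hindex : ∀ t : ℝ, 0 < t → ∃ n : ℕ, (n : ℝ) < t ∧ t ≤ n + 1 := by
    intro t ht
    have h1 : 0 < ⌈t⌉₊ := Nat.ceil_pos.2 ht
    have h2 : ((⌈t⌉₊ - 1 : ℕ) : ℝ) = ⌈t⌉₊ - 1 := by
      rw [Nat.cast_sub h1, Nat.cast_one]
    refine ⟨⌈t⌉₊ - 1, ?_, ?_⟩
    · rw [h2]; linarith [Nat.ceil_lt_add_one ht.le]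
    · rw [h2]; linarith [Nat.le_ceil t]
  have hne : ∀ s t : ℝ, 0 ≤ s → s < t → γ s ≠ γ t := by
    intro s t hs hst heq
    obtain ⟨n, hn1, hn2⟩ := hindex t (hs.trans_lt hst)
    rcases le_or_gt (n : ℝ) s with hns | hsn
    · rw [hγg n t ⟨hn1.le, hn2⟩, hγg n s ⟨hns, by linarith⟩] at heq
      have := (hg n).injOn (x₁ := s - n) (x₂ := t - n) ⟨by linarith, by linarith⟩
        ⟨by linarith, by linarith⟩ heq
      linarith
    · have hs1 := Nat.floor_le hs
      have hs2 := Nat.lt_floor_add_one s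
      have hmn : ⌊s⌋₊ < n := by exact_mod_cast hs1.trans_lt hsn
      have hsS : γ s ∈ S ⌊s⌋₊ := himage ⌊s⌋₊ ▸ mem_image_of_mem γ ⟨hs1, hs2.le⟩
      exact disjoint_left.1 (hS _ _ hmn) hsS (heq ▸ hmem n t hn1 hn2)
  refine ⟨γ, ?_, ?_, himage⟩
  · rw [contDiff_iff_contDiffAt]
    intro t
    obtain ⟨n, hn⟩ := exists_nat_gt t
    refine (hGdiff n).contDiffAt.congr_of_eventuallyEq ?_
    filter_upwards [Iio_mem_nhds hn] with s hs using hγG n s (le_of_lt hs)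
  · intro s hs t ht heq
    rcases lt_trichotomy s t with h | h | h
    · exact absurd heq (hne s t hs h)
    · exact h
    · exact absurd heq.symm (hne t s ht h)

/-- A shrinking sequence of connected open subsets of `U` which leaves every compact subset of `U`
and accumulates exactly on `K`. -/
structure IsEndNhds (U K : Set ℂ) (V : ℕ → Set ℂ) : Prop where
  isOpen : ∀ n, IsOpen (V n)
  isPreconnected : ∀ n, IsPreconnected (V n)
  antitone : Antitone V
  subset : ∀ n, V n ⊆ U
  exists_disjoint : ∀ S ⊆ U, IsCompact S → ∃ n, Disjoint (V n) S
  exists_subset_thickening : ∀ ε > 0, ∃ n, V n ⊆ thickening ε K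
  exists_dist_lt : ∀ q ∈ K, ∀ n, ∀ ε > 0, ∃ x ∈ V n, dist x q < ε

/-- `D` is a connected open set containing some `V m`, from which the point `a ∉ D` is accessible,
everything happening `ε`-close to `K`. -/
structure IsAccessNhd (U K : Set ℂ) (V : ℕ → Set ℂ) (ε : ℝ) (D : Set ℂ) (a : ℂ) : Prop where
  isOpen : IsOpen D
  isPreconnected : IsPreconnected D
  subset : D ⊆ U
  subset_thickening : D ⊆ thickening ε K
  mem : a ∈ U
  mem_thickening : a ∈ thickening ε K
  notMem : a ∉ D
  accessible : ∃ p ≠ a, segment ℝ a p \ {a} ⊆ D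
  exists_subset : ∃ m, V m ⊆ D

section

variable {U K : Set ℂ} {V : ℕ → Set ℂ}

lemma IsEndNhds.nonempty (hV : IsEndNhds U K V) (hK : K.Nonempty) (n : ℕ) : (V n).Nonempty :=
  let ⟨q, hq⟩ := hK
  let ⟨x, hx, _⟩ := hV.exists_dist_lt q hq n 1 one_pos
  ⟨x, hx⟩

lemma IsEndNhds.exists_disjoint_closure (hV : IsEndNhds U K V) (hU : IsOpen U) {S : Set ℂ}
    (hSU : S ⊆ U) (hS : IsCompact S) : ∃ n, Disjoint (closure (V n)) S := by
  obtain ⟨δ, hδ, hδU⟩ := hS.exists_cthickening_subset_open hU hSU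
  obtain ⟨n, hn⟩ := hV.exists_disjoint _ hδU hS.cthickening
  refine ⟨n, ?_⟩
  have h1 : Disjoint (V n) (thickening δ S) := hn.mono_right (thickening_subset_cthickening _ _)
  exact (h1.closure_left isOpen_thickening).mono_right (self_subset_thickening hδ _)

lemma IsEndNhds.exists_isAccessNhd (hV : IsEndNhds U K V) (hK : K.Nonempty)
    {ε : ℝ} (hε : 0 < ε) : ∃ D a, IsAccessNhd U K V ε D a := by
  obtain ⟨m, hm⟩ := hV.exists_subset_thickening ε hε
  obtain ⟨a, ha⟩ := hV.nonempty hK m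
  obtain ⟨n, hn⟩ := hV.exists_disjoint {a} (singleton_subset_iff.2 (hV.subset m ha))
    isCompact_singleton
  obtain ⟨r, hr, hra⟩ := Metric.isOpen_iff.1 (hV.isOpen m) a ha
  refine ⟨V m \ {a}, a, (hV.isOpen m).sdiff isClosed_singleton,
    (hV.isPreconnected m).sdiff_singleton_of_isOpen (hV.isOpen m) ha,
    sdiff_subset.trans (hV.subset m), sdiff_subset.trans hm, hV.subset m ha, hm ha,
    fun h => h.2 rfl, ?_, max m n, ?_⟩
  · obtain ⟨p, hp, hsub⟩ := exists_segment_subset_ball_slit a (one_ne_zero (α := ℂ)) hr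
    exact ⟨p, hp, fun x hx => ⟨hra (hsub hx).1, hx.2⟩⟩
  · intro x hx
    exact ⟨hV.antitone (le_max_left _ _) hx,
      disjoint_left.1 hn (hV.antitone (le_max_right _ _) hx)⟩

lemma IsAccessNhd.exists_polyArc {ε : ℝ} {D : Set ℂ} {a : ℂ} (h : IsAccessNhd U K V ε D a)
    (hV : IsEndNhds U K V) (hU : IsOpen U) {q : ℂ} (hq : q ∈ K) {ε' : ℝ} (hε' : 0 < ε') :
    ∃ D' b S, IsAccessNhd U K V ε' D' b ∧ PolyArc a S b ∧ a ≠ b ∧ S \ {a} ⊆ D ∧ Disjoint S D' ∧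
      D' ⊆ D ∧ ∃ x ∈ S, dist x q < ε' := by
  obtain ⟨m, hm⟩ := h.exists_subset
  obtain ⟨t, htV, htq⟩ := hV.exists_dist_lt q hq m ε' hε'
  have htD : t ∈ D := hm htV
  have hat : a ≠ t := fun e => h.notMem (e ▸ htD)
  obtain ⟨S₁, hS₁, hS₁D⟩ :=
    PolyArc.exists_of_accessible h.isPreconnected h.isOpen h.notMem h.accessible htD
  have hS₁U : S₁ ⊆ U := fun x hx => by
    by_cases hxa : x = a
    · exact hxa ▸ h.mem
    · exact h.subset (hS₁D ⟨hx, hxa⟩)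
  set D₁ := D \ S₁ with hD₁
  have hD₁o : IsOpen D₁ := h.isOpen.sdiff hS₁.isCompact.isClosed
  have hD₁c : IsPreconnected D₁ :=
    hS₁.isPreconnected_sdiff h.isPreconnected h.isOpen h.notMem hS₁D
  have ht₁ : t ∉ D₁ := fun ht => ht.2 hS₁.right_mem
  have hacc : ∃ p ≠ t, segment ℝ t p \ {t} ⊆ D₁ := by
    obtain ⟨u, hu, r, hr, hur⟩ := hS₁.exists_direction hat
    obtain ⟨r', hr', hr'D⟩ := Metric.isOpen_iff.1 h.isOpen t htD
    obtain ⟨p, hp, hsub⟩ := exists_segment_subset_ball_slit t hu (lt_min hr hr')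
    refine ⟨p, hp, fun x hx => ?_⟩
    obtain ⟨hx1, hx2⟩ := hsub hx
    exact ⟨hr'D (ball_subset_ball (min_le_right _ _) hx1),
      (hur x (ball_subset_ball (min_le_left _ _) hx1)).2 hx2⟩
  obtain ⟨n₁, hn₁⟩ := hV.exists_subset_thickening (ε' / 2) (by positivity)
  obtain ⟨n₂, hn₂⟩ := hV.exists_disjoint_closure hU hS₁U hS₁.isCompact
  obtain ⟨n, hnm, hnn₁, hnn₂⟩ : ∃ n, m ≤ n ∧ n₁ ≤ n ∧ n₂ ≤ n :=
    ⟨max m (max n₁ n₂), by simp, by simp, by simp⟩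
  set T := V n with hT
  have hTS₁ : Disjoint (closure T) S₁ := hn₂.mono_left (closure_mono (hV.antitone hnn₂))
  have hTD₁ : T ⊆ D₁ := fun x hx =>
    ⟨hm (hV.antitone hnm hx), disjoint_left.1 hTS₁ (subset_closure hx)⟩
  have hTK : closure T ⊆ thickening ε' K :=
    (closure_mono ((hV.antitone hnn₁).trans hn₁)).trans
      ((closure_thickening_subset_cthickening _ _).trans
        (cthickening_subset_thickening' hε' (half_lt_self hε') _))
  obtain ⟨y, hy⟩ := hV.nonempty ⟨q, hq⟩ n
  obtain ⟨S₂, hS₂, hS₂D⟩ := PolyArc.exists_of_accessible hD₁c hD₁o ht₁ hacc (hTD₁ hy)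
  have htC : t ∉ closure T := disjoint_right.1 hTS₁ hS₁.right_mem
  obtain ⟨S₃, b, hS₃, hS₃₂, hS₃C⟩ := hS₂.exists_truncate isClosed_closure htC
    ⟨y, hS₂.right_mem, subset_closure hy⟩
  have hbC : b ∈ closure T := (hS₃C ▸ mem_singleton b : b ∈ S₃ ∩ closure T).2
  have htb : t ≠ b := fun e => htC (e ▸ hbC)
  have hS₃D : S₃ \ {t} ⊆ D₁ := (sdiff_subset_sdiff_left hS₃₂).trans hS₂D
  have hbD₁ : b ∈ D₁ := hS₃D ⟨hS₃.right_mem, htb.symm⟩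
  have hS₁₃ : S₁ ∩ S₃ = {t} := by
    refine Subset.antisymm ?_ (singleton_subset_iff.2 ⟨hS₁.right_mem, hS₃.left_mem⟩)
    rintro x ⟨hx1, hx3⟩
    by_contra hxt
    exact (hS₃D ⟨hx3, hxt⟩).2 hx1
  obtain ⟨u, hu, r₀, hr₀, hur⟩ := hS₃.exists_direction htb
  have hnhds : ball b r₀ ∩ D₁ ∩ thickening ε' K ∈ 𝓝 b :=
    inter_mem (inter_mem (ball_mem_nhds b hr₀) (hD₁o.mem_nhds hbD₁))
      (isOpen_thickening.mem_nhds (hTK hbC))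
  obtain ⟨r, hr, hrsub⟩ := Metric.mem_nhds_iff.1 hnhds
  have hbT : b ∉ T := by
    intro hb
    have hc : Tendsto (fun s : ℝ => b - s * u) (𝓝[>] 0) (𝓝 b) := by
      have : Continuous fun s : ℝ => b - s * u := by fun_prop
      simpa using (this.tendsto 0).mono_left nhdsWithin_le_nhds
    obtain ⟨s, ⟨hsT, hsr⟩, hs⟩ := ((hc.eventually ((hV.isOpen n).mem_nhds hb)).and
      (hc.eventually (ball_mem_nhds b hr₀)) |>.and self_mem_nhdsWithin).exists
    have hs' : (0 : ℝ) < s := hs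
    have hsS : b - s * u ∈ S₃ := by
      by_contra hns
      exact (div_notMem_slitPlane_iff hu).2 ⟨s, hs'.le, rfl⟩ ((hur _ hsr).1 hns)
    have := eq_of_inter_eq_singleton hS₃C hsS (subset_closure hsT)
    have h0 : (s : ℂ) * u = 0 := by linear_combination -this
    rcases mul_eq_zero.1 h0 with h0 | h0
    · exact hs'.ne' (by exact_mod_cast h0)
    · exact hu h0
  set N : Set ℂ := ball b r ∩ {x | (x - b) / u ∈ Complex.slitPlane} with hN
  have hNo : IsOpen N := by
    refine isOpen_ball.inter (Complex.isOpen_slitPlane.preimage ?_)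
    fun_prop
  have hNS : ∀ x ∈ N, x ∉ S₃ := fun x hx => (hur x (hrsub hx.1).1.1).2 hx.2
  have hTS₃ : ∀ x ∈ T, x ∉ S₃ := fun x hx hx3 =>
    hbT (eq_of_inter_eq_singleton hS₃C hx3 (subset_closure hx) ▸ hx)
  have hTN : (T ∩ N).Nonempty := by
    obtain ⟨x, hxb, hxT⟩ := mem_closure_iff.1 hbC _ isOpen_ball (mem_ball_self hr)
    exact ⟨x, hxT, hxb, (hur x (hrsub hxb).1.1).1 (hTS₃ x hxT)⟩
  have hD'D₁ : T ∪ N ⊆ D₁ := union_subset hTD₁ fun x hx => (hrsub hx.1).1.2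
  refine ⟨T ∪ N, b, S₁ ∪ S₃, ?_, hS₁.trans hS₃ hS₁₃, ?_, ?_, ?_,
    hD'D₁.trans sdiff_subset, t, Or.inl hS₁.right_mem, htq⟩
  · refine ⟨(hV.isOpen n).union hNo, (hV.isPreconnected n).union' hTN
      ((convex_ball b r).isPreconnected_inter_slit isOpen_ball (mem_ball_self hr) hu),
      hD'D₁.trans (sdiff_subset.trans h.subset),
      union_subset (subset_closure.trans hTK) fun x hx => (hrsub hx.1).2,
      h.subset hbD₁.1, hTK hbC, ?_, ?_, n, subset_union_left⟩
    · rintro (hb | hb)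
      · exact hbT hb
      · exact hNS b hb hS₃.right_mem
    · obtain ⟨p, hp, hsub⟩ := exists_segment_subset_ball_slit b hu hr
      exact ⟨p, hp, hsub.trans subset_union_right⟩
  · rintro rfl
    exact h.notMem hbD₁.1
  · rintro x ⟨hx1 | hx3, hxa⟩
    · exact hS₁D ⟨hx1, hxa⟩
    · by_cases hxt : x = t
      · exact hxt ▸ htD
      · exact (hS₃D ⟨hx3, hxt⟩).1
  · rw [disjoint_right]
    rintro x hx (hx1 | hx3)
    · exact (hD'D₁ hx).2 hx1
    · rcases hx with hx | hx
      · exact hTS₃ x hx hx3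
      · exact hNS x hx hx3

/-- The ends described by `IsEndNhds` are traced by an injective smooth curve. -/
theorem IsEndNhds.exists_curve (hV : IsEndNhds U K V) (hU : IsOpen U) (hKc : IsClosed K)
    (hK : K.Nonempty) :
    ∃ γ : ℝ → ℂ, ContDiff ℝ (⊤ : ℕ∞) γ ∧ InjOn γ (Ici 0) ∧ (∀ t : ℝ, 0 ≤ t → γ t ∈ U) ∧
      {w : ℂ | ∃ t : ℕ → ℝ, (∀ n, 0 ≤ t n) ∧ Tendsto t atTop atTop ∧
        Tendsto (fun n => γ (t n)) atTop (𝓝 w)} = K := by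
  have : Nonempty K := hK.to_subtype
  let ε : ℕ → ℝ := fun n => 1 / (n + 1)
  have hε : ∀ n, 0 < ε n := fun n => by positivity
  have hε0 : Tendsto ε atTop (𝓝 0) := tendsto_one_div_add_atTop_nhds_zero_nat
  let q : ℕ → ℂ := fun n => (TopologicalSpace.denseSeq K n.unpair.1 : K)
  have hq : ∀ n, q n ∈ K := fun n => Subtype.coe_prop _
  obtain ⟨D₀, a₀, h₀⟩ := hV.exists_isAccessNhd hK (hε 0)
  choose! D' b S hgood harc hne hsub hdisj hmono hvisit using
    fun (n : ℕ) (D : Set ℂ) (a : ℂ) (h : IsAccessNhd U K V (ε n) D a) =>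
      h.exists_polyArc hV hU (hq n) (hε (n + 1))
  let X : ℕ → Set ℂ × ℂ := fun n =>
    Nat.rec (D₀, a₀) (fun n X => (D' n X.1 X.2, b n X.1 X.2)) n
  have hX : ∀ n, IsAccessNhd U K V (ε n) (X n).1 (X n).2 := by
    intro n
    induction n with
    | zero => exact h₀
    | succ n ih => exact hgood n _ _ ih
  let A : ℕ → Set ℂ := fun n => S n (X n).1 (X n).2
  have hA : ∀ n, PolyArc (X n).2 (A n) (X (n + 1)).2 := fun n => harc n _ _ (hX n)
  have hAD : ∀ n, A n \ {(X n).2} ⊆ (X n).1 := fun n => hsub n _ _ (hX n)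
  have hXanti : Antitone fun n => (X n).1 := antitone_nat_of_succ_le fun n => hmono n _ _ (hX n)
  have hAmem : ∀ n, ∀ x ∈ A n, x ∈ U ∩ thickening (ε n) K := by
    intro n x hx
    by_cases hxa : x = (X n).2
    · exact hxa ▸ ⟨(hX n).mem, (hX n).mem_thickening⟩
    · exact ⟨(hX n).subset (hAD n ⟨hx, hxa⟩), (hX n).subset_thickening (hAD n ⟨hx, hxa⟩)⟩
  choose g hg using fun n => (hA n).exists_isFlatArc (hne n _ _ (hX n))
  obtain ⟨γ, hγ, hinj, himg⟩ := exists_contDiff_injOn_of_isFlatArc hg fun m n hmn =>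
    ((hdisj m _ _ (hX m)).mono_right (hXanti hmn)).mono_right (hAD n)
  have hfloor : ∀ t : ℝ, 0 ≤ t → γ t ∈ A ⌊t⌋₊ := fun t ht =>
    himg ⌊t⌋₊ ▸ mem_image_of_mem γ ⟨Nat.floor_le ht, (Nat.lt_floor_add_one t).le⟩
  refine ⟨γ, hγ, hinj, fun t ht => (hAmem _ _ (hfloor t ht)).1, Subset.antisymm ?_ ?_⟩
  · rintro w ⟨t, ht0, ht, hw⟩
    have h1 : Tendsto (fun n => infDist (γ (t n)) K) atTop (𝓝 (infDist w K)) :=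
      ((continuous_infDist_pt K).tendsto w).comp hw
    have h2 : Tendsto (fun n => infDist (γ (t n)) K) atTop (𝓝 0) := by
      refine squeeze_zero (fun n => infDist_nonneg) (fun n => ?_)
        (hε0.comp (tendsto_nat_floor_atTop.comp ht))
      obtain ⟨y, hy, hyd⟩ := mem_thickening_iff.1 (hAmem _ _ (hfloor _ (ht0 n))).2
      exact (infDist_le_dist_of_mem hy).trans hyd.le
    exact (hKc.mem_iff_infDist_zero hK).2 (tendsto_nhds_unique h1 h2)
  · intro w hw
    have key : ∀ N : ℕ, ∃ t : ℝ, (N : ℝ) ≤ t ∧ dist (γ t) w < ε N := by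
      intro N
      obtain ⟨i, hi⟩ : ∃ i, dist (TopologicalSpace.denseSeq K i) (⟨w, hw⟩ : K) < ε N / 2 := by
        obtain ⟨_, h, i, rfl⟩ := Metric.dense_iff.1 (TopologicalSpace.denseRange_denseSeq K)
          (⟨w, hw⟩ : K) (ε N / 2) (half_pos (hε N))
        exact ⟨i, h⟩
      set k := Nat.pair i (2 * N + 1) with hk
      have hkN : 2 * N + 1 ≤ k := Nat.right_le_pair _ _
      obtain ⟨x, hx, hxq⟩ := hvisit k _ _ (hX k)
      obtain ⟨t, ht, rfl⟩ : x ∈ γ '' Icc (k : ℝ) (k + 1) := himg k ▸ hx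
      have hkN' : 2 * (N : ℝ) + 1 ≤ k := by exact_mod_cast hkN
      have hqk : dist (q k) w < ε N / 2 := by
        simpa [q, hk, Subtype.dist_eq] using hi
      have hεk : ε (k + 1) ≤ ε N / 2 := by
        simp only [ε, div_div]
        push_cast
        gcongr
        linarith
      refine ⟨t, by have := ht.1; linarith [N.cast_nonneg (α := ℝ)], ?_⟩
      linarith [dist_triangle (γ t) (q k) w]
    choose t ht htw using key
    refine ⟨t, fun n => n.cast_nonneg.trans (ht n),
      tendsto_atTop_mono ht tendsto_natCast_atTop_atTop, ?_⟩
    exact tendsto_iff_dist_tendsto_zero.2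
      (squeeze_zero (fun n => dist_nonneg) (fun n => (htw n).le) hε0)

end

/-- Harnack's inequality for `-log ‖h‖`, in a multiplicative form. -/
lemma norm_sq_le_norm_zero_of_norm_lt_one {h : ℂ → ℂ} {R : ℝ} (hR : 0 < R)
    (hd : DifferentiableOn ℂ h (ball 0 R)) (h0 : ∀ y ∈ ball 0 R, h y ≠ 0)
    (h1 : ∀ y ∈ ball 0 R, ‖h y‖ < 1) {y : ℂ} (hy : ‖y‖ ≤ R / 5) : ‖h y‖ ^ 2 ≤ ‖h 0‖ := by
  have h0R : (0 : ℂ) ∈ ball 0 R := mem_ball_self hR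
  have hyR : y ∈ ball 0 R := by rw [mem_ball_zero_iff]; linarith
  obtain ⟨F, hF0, hF⟩ :=
    ((hd.deriv isOpen_ball).div hd h0).isExactOn_ball.with_val_at 0 0
  have hFexp : ∀ w ∈ ball 0 R, h w = h 0 * Complex.exp (F w) := by
    intro w hw
    have hder : ∀ x ∈ ball (0 : ℂ) R, HasDerivAt (fun x => h x * Complex.exp (-F x)) 0 x := by
      intro x hx
      have e1 := (hd.differentiableAt (isOpen_ball.mem_nhds hx)).hasDerivAt
      refine HasDerivAt.congr_deriv (e1.mul (hF x hx).neg.cexp) ?_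
      have := h0 x hx
      simp only [Pi.div_apply, Pi.neg_apply]
      field_simp
      ring
    have hc := isOpen_ball.is_const_of_deriv_eq_zero (convex_ball (0 : ℂ) R).isPreconnected
      (fun x hx => (hder x hx).differentiableAt.differentiableWithinAt)
      (fun x hx => (hder x hx).deriv) hw h0R
    simp only [hF0, neg_zero, Complex.exp_zero, mul_one] at hc
    rw [← hc, mul_assoc, ← Complex.exp_add, neg_add_cancel, Complex.exp_zero, mul_one]
  set M := -Real.log ‖h 0‖ with hM
  have hpos : 0 < ‖h 0‖ := norm_pos_iff.2 (h0 0 h0R)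
  have hM0 : 0 < M := neg_pos.2 (Real.log_neg hpos (h1 0 h0R))
  have hexp : ‖h 0‖ = Real.exp (-M) := by rw [hM, neg_neg, Real.exp_log hpos]
  have hnorm : ∀ w ∈ ball 0 R, ‖h w‖ = Real.exp (-M + (F w).re) := by
    intro w hw
    rw [hFexp w hw, norm_mul, Complex.norm_exp, hexp, Real.exp_add]
  have hre : ∀ w ∈ ball 0 R, (F w).re ≤ M := by
    intro w hw
    have := h1 w hw
    rw [hnorm w hw, Real.exp_lt_one_iff] at this
    linarith
  have hB := Complex.borelCaratheodory_zero hM0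
    (fun x hx => (hF x hx).differentiableAt.differentiableWithinAt) hre hR hyR hF0
  have hB' : ‖F y‖ ≤ M / 2 := by
    refine hB.trans ?_
    rw [div_le_iff₀ (by linarith)]
    nlinarith
  rw [hnorm y hyR, hexp, ← Real.exp_nat_mul]
  gcongr
  have := (Complex.re_le_norm (F y)).trans hB'
  push_cast
  linarith

/-- A holomorphic map on a disc into a bounded set `U` which takes the centre close to a point
`ζ ∉ U` takes a smaller concentric disc close to `ζ`. -/
lemma dist_sq_le_mul_dist_of_mapsTo {g : ℂ → ℂ} {U : Set ℂ} {x y ζ : ℂ} {R M : ℝ} (hR : 0 < R)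
    (hg : DifferentiableOn ℂ g (ball x R)) (hgU : MapsTo g (ball x R) U) (hζ : ζ ∉ U)
    (hM : ∀ p ∈ U, dist p ζ < M) (hy : dist y x ≤ R / 5) :
    dist (g y) ζ ^ 2 ≤ M * dist (g x) ζ := by
  have hM0 : 0 < M := dist_nonneg.trans_lt (hM _ (hgU (mem_ball_self hR)))
  have hMC : (M : ℂ) ≠ 0 := by exact_mod_cast hM0.ne'
  have hmaps : MapsTo (fun w => x + w) (ball 0 R) (ball x R) := fun w hw => by
    simpa [dist_eq_norm] using hw
  have key := norm_sq_le_norm_zero_of_norm_lt_one (h := fun w => (g (x + w) - ζ) / M) hR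
    (y := y - x) ?_ ?_ ?_ (by rwa [← dist_eq_norm])
  · simp only [add_sub_cancel, add_zero, norm_div, Complex.norm_real, Real.norm_eq_abs,
      abs_of_pos hM0, ← dist_eq_norm, div_pow] at key
    rw [div_le_div_iff₀ (by positivity) hM0] at key
    refine le_of_mul_le_mul_right ?_ hM0
    linarith
  · have hcomp : DifferentiableOn ℂ (fun w => g (x + w)) (ball 0 R) :=
      hg.comp (by fun_prop) hmaps
    exact (hcomp.sub_const ζ).div_const (M : ℂ)
  · intro w hw
    exact div_ne_zero (sub_ne_zero.2 fun e => hζ (e ▸ hgU (hmaps hw))) hMC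
  · intro w hw
    rw [norm_div, Complex.norm_real, Real.norm_eq_abs, abs_of_pos hM0, div_lt_one hM0,
      ← dist_eq_norm]
    exact hM _ (hgU (hmaps hw))

section

variable {U : Set ℂ} {g : ℕ → ℂ → ℂ}

lemma frontier_nonempty_of_isBounded (hb : Bornology.IsBounded U) (hne : U.Nonempty) :
    (frontier U).Nonempty := by
  rw [nonempty_iff_ne_empty, Ne, frontier_eq_empty_iff]
  rintro (rfl | rfl)
  · exact not_nonempty_empty hne
  · exact NormedSpace.unbounded_univ ℂ ℂ hb

lemma eventually_forall_dist_lt_of_infDist_frontier (hU : IsOpen U) (hb : Bornology.IsBounded U)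
    (hg : ∀ n, DifferentiableOn ℂ (g n) U) (hgU : ∀ n, MapsTo (g n) U U) {x : ℂ} {R : ℝ}
    (hR : 0 < R) (hxR : ball x R ⊆ U)
    (hx : Tendsto (fun n => infDist (g n x) (frontier U)) atTop (𝓝 0)) {ε : ℝ} (hε : 0 < ε) :
    ∀ᶠ n in atTop, ∀ y, dist y x ≤ R / 5 → dist (g n y) (g n x) < ε := by
  have hxU : x ∈ U := hxR (mem_ball_self hR)
  have hfr := frontier_nonempty_of_isBounded hb ⟨x, hxU⟩
  obtain ⟨M, hM0, hM⟩ : ∃ M > 0, ∀ p ∈ closure U, ∀ q ∈ closure U, dist p q < M :=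
    ⟨diam (closure U) + 1, by positivity, fun p hp q hq =>
      (dist_le_diam_of_mem hb.closure hp hq).trans_lt (lt_add_one _)⟩
  have hδ : 0 < min (ε / 2) (ε ^ 2 / (4 * M)) := by positivity
  filter_upwards [hx.eventually (gt_mem_nhds hδ)] with n hn y hy
  obtain ⟨ζ, hζ, hζd⟩ := isClosed_frontier.exists_infDist_eq_dist hfr (g n x)
  obtain ⟨hn1, hn2⟩ := lt_min_iff.1 (hζd ▸ hn)
  rw [lt_div_iff₀ (by positivity)] at hn2
  have hζU : ζ ∉ U := (hU.frontier_eq ▸ hζ).2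
  have h2 := dist_sq_le_mul_dist_of_mapsTo hR ((hg n).mono hxR)
    ((hgU n).mono_left hxR) hζU
    (fun p hp => hM p (subset_closure hp) ζ (frontier_subset_closure hζ)) hy
  have h3 : dist (g n y) ζ < ε / 2 := by
    refine lt_of_pow_lt_pow_left₀ 2 (by positivity) ?_
    nlinarith
  linarith [dist_triangle_right (g n y) (g n x) ζ]

/-- If a sequence of holomorphic self-maps of a bounded domain takes one point to the boundary, then
all the orbits are asymptotic, uniformly on compact sets. -/
lemma eventually_forall_isCompact_dist_lt (hU : IsOpen U) (hc : IsPreconnected U)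
    (hb : Bornology.IsBounded U) (hg : ∀ n, DifferentiableOn ℂ (g n) U)
    (hgU : ∀ n, MapsTo (g n) U U) {z : ℂ} (hz : z ∈ U)
    (hesc : Tendsto (fun n => infDist (g n z) (frontier U)) atTop (𝓝 0))
    {C : Set ℂ} (hC : IsCompact C) (hCU : C ⊆ U) {ε : ℝ} (hε : 0 < ε) :
    ∀ᶠ n in atTop, ∀ y ∈ C, dist (g n y) (g n z) < ε := by
  set T : Set ℂ := {x | Tendsto (fun n => dist (g n x) (g n z)) atTop (𝓝 0)} with hT
  have hTesc : ∀ x ∈ T, Tendsto (fun n => infDist (g n x) (frontier U)) atTop (𝓝 0) := by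
    intro x hx
    refine squeeze_zero (fun n => infDist_nonneg)
      (fun n => infDist_le_infDist_add_dist (y := g n z)) ?_
    simpa using hesc.add hx
  have hball : ∀ x ∈ T, ∀ R > 0, ball x R ⊆ U → ∀ ε > 0,
      ∀ᶠ n in atTop, ∀ y, dist y x ≤ R / 5 → dist (g n y) (g n z) < ε := by
    intro x hx R hR hxR ε hε
    filter_upwards [eventually_forall_dist_lt_of_infDist_frontier hU hb hg hgU hR hxR
      (hTesc x hx) (half_pos hε), hx.eventually (gt_mem_nhds (half_pos hε))] with n h1 h2 y hy
    linarith [h1 y hy, dist_triangle (g n y) (g n x) (g n z)]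
  have hballT : ∀ x ∈ T, ∀ R > 0, ball x R ⊆ U → ∀ y, dist y x ≤ R / 5 → y ∈ T := by
    intro x hx R hR hxR y hy
    rw [hT, mem_ofPred_eq, Metric.tendsto_atTop']
    intro ε hε
    obtain ⟨N, hN⟩ := eventually_atTop.1 (hball x hx R hR hxR ε hε)
    exact ⟨N, fun n hn => by simpa using hN n hn.le y hy⟩
  have hUT : U ⊆ T := by
    have hsub : U ⊆ interior T ∩ U := by
      refine hc.subset_of_closure_inter_subset (isOpen_interior.inter hU) ⟨z, hz, ?_, hz⟩ ?_
      · obtain ⟨R, hR, hzR⟩ := Metric.isOpen_iff.1 hU z hz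
        have hzT : z ∈ T := by simp [hT]
        exact mem_interior_iff_mem_nhds.2 (Filter.mem_of_superset
          (closedBall_mem_nhds z (by positivity)) (hballT z hzT R hR hzR))
      · rintro x ⟨hxc, hxU⟩
        refine ⟨?_, hxU⟩
        obtain ⟨R, hR, hxR⟩ := Metric.isOpen_iff.1 hU x hxU
        obtain ⟨x', hx', hxx'⟩ := Metric.mem_closure_iff.1 hxc (R / 10) (by positivity)
        have hxT : x ∈ T := by
          refine hballT x' (interior_subset hx'.1) (R / 2) (by positivity) ?_ x (by linarith)
          refine (ball_subset_ball' ?_).trans hxR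
          rw [dist_comm]
          linarith
        exact mem_interior_iff_mem_nhds.2 (Filter.mem_of_superset
          (closedBall_mem_nhds x (by positivity)) (hballT x hxT R hR hxR))
    exact hsub.trans (inter_subset_left.trans interior_subset)
  refine hC.induction_on (p := fun s => ∀ᶠ n in atTop, ∀ y ∈ s, dist (g n y) (g n z) < ε)
    (by simp) (fun s t hst ht => ht.mono fun n h y hy => h y (hst hy)) ?_ ?_
  · intro s t hs ht
    filter_upwards [hs, ht] with n h1 h2 y hy
    exact hy.elim (h1 y) (h2 y)
  · intro x hx
    obtain ⟨R, hR, hxR⟩ := Metric.isOpen_iff.1 hU x (hCU hx)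
    exact ⟨closedBall x (R / 5), mem_nhdsWithin_of_mem_nhds (closedBall_mem_nhds x (by positivity)),
      hball x (hUT (hCU hx)) R hR hxR ε hε⟩

end

lemma IsPreconnected.thickening {C : Set ℂ} (hC : IsPreconnected C) (δ : ℝ) :
    IsPreconnected (thickening δ C) := by
  rw [← add_ball_zero, ← Set.add_image_prod]
  exact (hC.prod (convex_ball (0 : ℂ) δ).isPreconnected).image _ (by fun_prop)

lemma mapClusterPt_atTop_iff_exists_strictMono {u : ℕ → ℂ} {w : ℂ} :
    MapClusterPt w atTop u ↔ ∃ k : ℕ → ℕ, StrictMono k ∧ Tendsto (fun j => u (k j)) atTop (𝓝 w) :=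
  ⟨fun h => h.tendsto_subseq, fun ⟨_, hk, h⟩ => h.mapClusterPt.of_comp hk.tendsto_atTop⟩

lemma eventually_mem_thickening_mapClusterPt {u : ℕ → ℂ} {s : Set ℂ} (hs : Bornology.IsBounded s)
    (hu : ∀ n, u n ∈ s) {ε : ℝ} (hε : 0 < ε) :
    ∀ᶠ n in atTop, u n ∈ thickening ε {w | MapClusterPt w atTop u} := by
  by_contra h
  obtain ⟨φ, hφ, hφu⟩ := extraction_of_frequently_atTop (not_eventually.1 h)
  obtain ⟨w, -, ψ, hψ, hw⟩ := tendsto_subseq_of_bounded hs fun n => hu (φ n)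
  have hwK : w ∈ {w | MapClusterPt w atTop u} :=
    mapClusterPt_atTop_iff_exists_strictMono.2 ⟨φ ∘ ψ, hφ.comp hψ, hw⟩
  obtain ⟨n, hn⟩ := (hw.eventually
    (isOpen_thickening.mem_nhds (self_subset_thickening hε _ hwK))).exists
  exact hφu _ hn

/-- The tails of a chain of thin neighbourhoods joining consecutive points of the orbit. -/
lemma exists_isEndNhds_of_infDist_frontier {U : Set ℂ} (hU : IsOpen U) (hc : IsConnected U)
    (hb : Bornology.IsBounded U) {f : ℂ → ℂ} (hf : DifferentiableOn ℂ f U) (hfU : MapsTo f U U)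
    {z : ℂ} (hz : z ∈ U)
    (hesc : Tendsto (fun n : ℕ => infDist (f^[n] z) (frontier U)) atTop (𝓝 0)) :
    ∃ V, IsEndNhds U {w | MapClusterPt w atTop fun n => f^[n] z} V := by
  have hfn : ∀ n, DifferentiableOn ℂ f^[n] U := hf.iterate hfU
  have hfnU : ∀ n, MapsTo f^[n] U U := fun n => hfU.iterate n
  have hfr := frontier_nonempty_of_isBounded hb ⟨z, hz⟩
  obtain ⟨p, hp⟩ := (hU.isConnected_iff_isPathConnected.1 hc).joinedIn z hz (f z) (hfU hz)
  set C := range p with hC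
  have hCU : C ⊆ U := range_subset_iff.2 hp
  have hCc : IsCompact C := isCompact_range p.continuous
  have hzC : z ∈ C := ⟨0, p.source⟩
  have hfzC : f z ∈ C := ⟨1, p.target⟩
  have hΓU : ∀ m, f^[m] '' C ⊆ U := fun m => ((hfnU m).mono_left hCU).image_subset
  have hδ : ∀ m : ℕ, ∃ δ > 0, δ ≤ 1 / ((m : ℝ) + 1) ∧ thickening δ (f^[m] '' C) ⊆ U := by
    intro m
    obtain ⟨δ, hδ, h⟩ := (hCc.image_of_continuousOn
      ((hfn m).continuousOn.mono hCU)).exists_thickening_subset_open hU (hΓU m)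
    exact ⟨min δ (1 / ((m : ℝ) + 1)), by positivity, min_le_right _ _,
      (thickening_mono (min_le_left _ _) _).trans h⟩
  choose δ hδ0 hδ1 hδU using hδ
  set W : ℕ → Set ℂ := fun m => thickening (δ m) (f^[m] '' C) with hW
  have hWpre : ∀ m, IsPreconnected (W m) := fun m =>
    ((isPreconnected_range p.continuous).image _
      ((hfn m).continuousOn.mono hCU)).thickening _
  have hWmem : ∀ m, ∀ y ∈ C, f^[m] y ∈ W m := fun m y hy =>
    self_subset_thickening (hδ0 m) _ (mem_image_of_mem _ hy)
  have key : ∀ ε > 0, ∃ N, ∀ m ≥ N, ∀ x ∈ W m, dist x (f^[m] z) < ε := by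
    intro ε hε
    refine eventually_atTop.1 ?_
    filter_upwards [eventually_forall_isCompact_dist_lt hU hc.isPreconnected hb hfn hfnU hz hesc
      hCc hCU (half_pos hε), tendsto_one_div_add_atTop_nhds_zero_nat.eventually
      (gt_mem_nhds (half_pos hε))] with m h1 h2 x hx
    obtain ⟨_, ⟨y, hy, rfl⟩, hxy⟩ := mem_thickening_iff.1 hx
    linarith [h1 y hy, hδ1 m, dist_triangle x (f^[m] y) (f^[m] z)]
  refine ⟨fun n => ⋃ m ∈ Ici n, W m, ?_, ?_, ?_, ?_, ?_, ?_, ?_⟩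
  · exact fun n => isOpen_biUnion fun m _ => isOpen_thickening
  · refine fun n => IsPreconnected.biUnion_of_chain ordConnected_Ici (fun m _ => hWpre m)
      fun m _ _ => ⟨f^[m] (f z), hWmem m _ hfzC, ?_⟩
    rw [← Function.iterate_succ_apply]
    exact hWmem (m + 1) z hzC
  · exact fun m n hmn => biUnion_subset_biUnion_left (Ici_subset_Ici.2 hmn)
  · exact fun n => iUnion₂_subset fun m _ => hδU m
  · intro S hSU hS
    obtain ⟨ε, hε, hεU⟩ := hS.exists_thickening_subset_open hU hSU
    obtain ⟨N, hN⟩ := key (ε / 2) (half_pos hε)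
    obtain ⟨N', hN'⟩ := eventually_atTop.1 (hesc.eventually (gt_mem_nhds (half_pos hε)))
    refine ⟨max N N', disjoint_left.2 fun x hx hxS => ?_⟩
    simp only [mem_iUnion₂, mem_Ici, max_le_iff] at hx
    obtain ⟨m, ⟨hm, hm'⟩, hxm⟩ := hx
    have hlt : infDist x (frontier U) < ε := by
      have h := infDist_le_infDist_add_dist (s := frontier U) (x := x) (y := f^[m] z)
      linarith [hN m hm x hxm, hN' m hm']
    obtain ⟨y, hy, hxy⟩ := (infDist_lt_iff hfr).1 hlt
    exact (hU.frontier_eq ▸ hy).2 (hεU (mem_thickening_iff.2 ⟨x, hxS, by rwa [dist_comm]⟩))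
  · intro ε hε
    obtain ⟨N, hN⟩ := key (ε / 2) (half_pos hε)
    obtain ⟨N', hN'⟩ := eventually_atTop.1 (eventually_mem_thickening_mapClusterPt hb
      (fun n => hfnU n hz) (half_pos hε))
    refine ⟨max N N', iUnion₂_subset fun m hm x hx => ?_⟩
    obtain ⟨y, hy, hd⟩ := mem_thickening_iff.1 (hN' m ((le_max_right _ _).trans hm))
    refine mem_thickening_iff.2 ⟨y, hy, ?_⟩
    linarith [hN m ((le_max_left _ _).trans hm) x hx, dist_triangle x (f^[m] z) y]
  · intro q hq n ε hε
    obtain ⟨m, hm, hmn⟩ := ((MapClusterPt.frequently hq (ball_mem_nhds q hε)).and_eventually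
      (eventually_ge_atTop n)).exists
    exact ⟨f^[m] z, mem_iUnion₂.2 ⟨m, hmn, hWmem m z hzC⟩, hm⟩

/-- **Curves in Baker domains, planar case.**
Let `U ⊆ ℂ` be a bounded domain, `f` holomorphic on `U` with `f(U) ⊆ U`, and `z ∈ U`
with `dist (f^[n] z) (∂U) → 0`.  If `K` is the set of accumulation points of the orbit
`(f^[n] z)`, then there is an injective `C^∞` curve `γ : [0,∞) → U` whose accumulation
set is exactly `K`. -/
theorem smooth_curve_with_orbit_accumulation_set
    (U : Set ℂ) (hUopen : IsOpen U) (hUconn : IsConnected U)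
    (hUbdd : Bornology.IsBounded U)
    (f : ℂ → ℂ) (hf : DifferentiableOn ℂ f U) (hfU : Set.MapsTo f U U)
    (z : ℂ) (hz : z ∈ U)
    (hesc : Filter.Tendsto (fun n : ℕ => Metric.infDist (f^[n] z) (frontier U))
      Filter.atTop (nhds 0))
    (K : Set ℂ)
    (hK : K = {w : ℂ | ∃ k : ℕ → ℕ, StrictMono k ∧
        Filter.Tendsto (fun j => f^[k j] z) Filter.atTop (nhds w)}) :
    ∃ γ : ℝ → ℂ,
      ContDiffOn ℝ (⊤ : ℕ∞) γ (Set.Ici 0) ∧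
      Set.InjOn γ (Set.Ici 0) ∧
      (∀ t : ℝ, 0 ≤ t → γ t ∈ U) ∧
      {w : ℂ | ∃ t : ℕ → ℝ, (∀ n, 0 ≤ t n) ∧
          Filter.Tendsto t Filter.atTop Filter.atTop ∧
          Filter.Tendsto (fun n => γ (t n)) Filter.atTop (nhds w)} = K := by
  have hKeq : K = {w | MapClusterPt w atTop fun n => f^[n] z} := by
    rw [hK]
    ext w
    exact (mapClusterPt_atTop_iff_exists_strictMono (u := fun n => f^[n] z)).symm
  have hne : K.Nonempty := by
    obtain ⟨w, -, k, hk, hw⟩ := tendsto_subseq_of_bounded hUbdd fun n => hfU.iterate n hz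
    exact hK ▸ ⟨w, k, hk, hw⟩
  obtain ⟨V, hV⟩ := exists_isEndNhds_of_infDist_frontier hUopen hUconn hUbdd hf hfU hz hesc
  rw [← hKeq] at hV
  have hKc : IsClosed K := hKeq ▸ isClosed_setOfPred_clusterPt
  obtain ⟨γ, h1, h2, h3, h4⟩ := hV.exists_curve hUopen hKc hne
  exact ⟨γ, h1.contDiffOn, h2, h3, h4⟩
end

section
/- Let U ⊆ ℂ be a bounded domain, let f be holomorphic on U with f(U) ⊆ U, and let z ∈ U satisfy dist(f^n(z), ∂U) → 0 as n → ∞. Then the set of accumulation points of the sequence (f^n(z)) is a nonempty, compact, connected subset of ∂U. -/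
open Set Filter Topology Metric

/-- A nonvanishing holomorphic function on a disk is a constant times an exponential. -/
theorem exists_eq_mul_exp_of_ne_zero_on_ball {g : ℂ → ℂ} {w : ℂ} {R : ℝ}
    (hg : DifferentiableOn ℂ g (ball w R)) (hg0 : ∀ x ∈ ball w R, g x ≠ 0) (hR : 0 < R) :
    ∃ L : ℂ → ℂ, DifferentiableOn ℂ L (ball w R) ∧ L w = 0 ∧
      ∀ x ∈ ball w R, g x = g w * Complex.exp (L x) := by
  have hd : DifferentiableOn ℂ (fun x => deriv g x / g x) (ball w R) :=
    (hg.deriv isOpen_ball).div hg hg0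
  obtain ⟨L, hLw, hL⟩ := hd.isExactOn_ball.with_val_at w 0
  refine ⟨L, fun x hx => (hL x hx).differentiableAt.differentiableWithinAt, hLw, fun x hx => ?_⟩
  have hder : ∀ y ∈ ball w R, HasDerivAt (fun y => g y * Complex.exp (-L y)) 0 y := by
    intro y hy
    have h1 := (hg.differentiableAt (isOpen_ball.mem_nhds hy)).hasDerivAt
    refine (h1.mul (hL y hy).neg.cexp).congr_deriv ?_
    have := hg0 y hy
    field_simp
    ring
  have hconst := isOpen_ball.is_const_of_deriv_eq_zero (convex_ball w R).isPreconnected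
    (fun y hy => (hder y hy).differentiableAt.differentiableWithinAt)
    (fun y hy => (hder y hy).deriv) hx (mem_ball_self hR)
  simp only [hLw, neg_zero, Complex.exp_zero, mul_one] at hconst
  rw [← hconst, mul_assoc, ← Complex.exp_add, neg_add_cancel, Complex.exp_zero, mul_one]

/-- A Harnack-type inequality for bounded nonvanishing holomorphic functions. -/
theorem norm_pow_three_le_of_ne_zero_on_ball {g : ℂ → ℂ} {w c : ℂ} {R M : ℝ}
    (hg : DifferentiableOn ℂ g (ball w R)) (hg0 : ∀ x ∈ ball w R, g x ≠ 0)
    (hM : ∀ x ∈ ball w R, ‖g x‖ < M) (hR : 0 < R) (hc : dist c w ≤ R / 2) :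
    ‖g w‖ ^ 3 ≤ M ^ 2 * ‖g c‖ := by
  obtain ⟨L, hLd, hLw, hL⟩ := exists_eq_mul_exp_of_ne_zero_on_ball hg hg0 hR
  have hw : w ∈ ball w R := mem_ball_self hR
  have hcb : c ∈ ball w R := mem_ball.2 (by linarith)
  have hgw : 0 < ‖g w‖ := norm_pos_iff.2 (hg0 w hw)
  have hMw := hM w hw
  have hM0 : 0 < M := hgw.trans hMw
  set A := Real.log (M / ‖g w‖) with hA
  have hA0 : 0 < A := Real.log_pos ((one_lt_div hgw).2 hMw)
  have hexpA : Real.exp A = M / ‖g w‖ := Real.exp_log (by positivity)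
  have hmaps : MapsTo (fun ζ => w + ζ) (ball 0 R) (ball w R) := by
    intro ζ hζ
    simpa [dist_eq_norm] using hζ
  have hmem : c - w ∈ ball (0 : ℂ) R := by simpa [dist_eq_norm] using hcb
  have key := Complex.borelCaratheodory_zero (f := fun ζ => L (w + ζ)) hA0
    (hLd.comp (by fun_prop) hmaps) (fun ζ hζ => by
      have hb := hM _ (hmaps hζ)
      rw [hL _ (hmaps hζ), norm_mul, Complex.norm_exp] at hb
      change (L (w + ζ)).re ≤ A
      rw [← Real.exp_le_exp, hexpA, le_div_iff₀ hgw]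
      linarith) hR hmem (by simpa using hLw)
  simp only [add_sub_cancel] at key
  have hcw : ‖c - w‖ ≤ R / 2 := by rwa [← dist_eq_norm]
  have hkey : ‖L c‖ ≤ 2 * A := by
    refine key.trans ?_
    rw [div_le_iff₀ (by linarith)]
    nlinarith
  have hre : -(2 * A) ≤ (L c).re := by
    linarith [neg_abs_le (L c).re, Complex.abs_re_le_norm (L c)]
  have hlow : (M / ‖g w‖) ^ 2 * Real.exp (L c).re ≥ 1 := by
    rw [← hexpA, ← Real.exp_nat_mul, ← Real.exp_add]
    apply Real.one_le_exp
    push_cast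
    linarith
  rw [hL c hcb, norm_mul, Complex.norm_exp]
  calc ‖g w‖ ^ 3 ≤ ‖g w‖ ^ 3 * ((M / ‖g w‖) ^ 2 * Real.exp (L c).re) :=
        le_mul_of_one_le_right (by positivity) hlow
    _ = _ := by field_simp

/-- For uniformly bounded nonvanishing holomorphic functions on a domain, convergence to zero
propagates from one point to every other. -/
theorem tendsto_zero_of_tendsto_zero_of_ne_zero {U : Set ℂ} (hUo : IsOpen U)
    (hUc : IsPreconnected U) {g : ℕ → ℂ → ℂ} {M : ℝ}
    (hg : ∀ n, DifferentiableOn ℂ (g n) U) (hg0 : ∀ n, ∀ x ∈ U, g n x ≠ 0)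
    (hM : ∀ n, ∀ x ∈ U, ‖g n x‖ < M) {z w : ℂ} (hz : z ∈ U) (hw : w ∈ U)
    (h : Tendsto (fun n => g n z) atTop (𝓝 0)) : Tendsto (fun n => g n w) atTop (𝓝 0) := by
  have local_step : ∀ (a b : ℂ) (R : ℝ), 0 < R → ball b R ⊆ U → dist a b ≤ R / 2 →
      Tendsto (fun n => g n a) atTop (𝓝 0) → Tendsto (fun n => g n b) atTop (𝓝 0) := by
    intro a b R hR hb hab ha
    have hle : ∀ n, ‖g n b‖ ^ 3 ≤ M ^ 2 * ‖g n a‖ := fun n =>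
      norm_pow_three_le_of_ne_zero_on_ball ((hg n).mono hb) (fun x hx => hg0 n x (hb hx))
        (fun x hx => hM n x (hb hx)) hR hab
    have hcube : Tendsto (fun n => ‖g n b‖ ^ 3) atTop (𝓝 0) := by
      refine squeeze_zero (fun n => by positivity) hle ?_
      simpa using ha.norm.const_mul (M ^ 2)
    rw [tendsto_zero_iff_norm_tendsto_zero]
    refine Metric.tendsto_atTop.2 fun ε hε => ?_
    obtain ⟨N, hN⟩ := Metric.tendsto_atTop.1 hcube (ε ^ 3) (by positivity)
    refine ⟨N, fun n hn => ?_⟩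
    have := hN n hn
    simp only [dist_zero_right, norm_pow, norm_norm] at this ⊢
    exact lt_of_pow_lt_pow_left₀ 3 hε.le this
  refine hUc.induction₂'
    (fun a b => Tendsto (fun n => g n a) atTop (𝓝 0) → Tendsto (fun n => g n b) atTop (𝓝 0))
    (fun x hx => ?_) (fun _ _ _ _ _ _ hab hbc ha => hbc (hab ha)) hz hw h
  obtain ⟨R, hR, hball⟩ := Metric.isOpen_iff.1 hUo x hx
  filter_upwards [mem_nhdsWithin_of_mem_nhds (ball_mem_nhds x (by positivity : 0 < R / 3))]
    with y hy
  have hy' : dist y x < R / 3 := hy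
  refine ⟨local_step x y (2 * R / 3) (by positivity) ?_ ?_, local_step y x R hR hball (by linarith)⟩
  · exact (ball_subset_ball' (by linarith)).trans hball
  · rw [dist_comm]
    linarith

/-- The accumulation set of a sequence in a compact set whose consecutive distances tend to zero
is preconnected. -/
theorem isPreconnected_setOf_mapClusterPt {X : Type*} [MetricSpace X] {K : Set X}
    (hK : IsCompact K) {x : ℕ → X} (hx : ∀ n, x n ∈ K)
    (hstep : Tendsto (fun n => dist (x (n + 1)) (x n)) atTop (𝓝 0)) :
    IsPreconnected {w | MapClusterPt w atTop x} := by
  have hclosed : IsClosed {w | MapClusterPt w atTop x} := isClosed_setOfPred_clusterPt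
  have hsub : {w | MapClusterPt w atTop x} ⊆ K := fun w hw =>
    hK.isClosed.mem_of_mapClusterPt hw (.of_forall hx)
  have hcpt : IsCompact {w | MapClusterPt w atTop x} := hK.of_isClosed_subset hclosed hsub
  rw [isPreconnected_iff_subset_of_fully_disjoint_closed hclosed]
  intro u v hu hv huv hdisj
  set S := {w | MapClusterPt w atTop x} with hS
  obtain ⟨δ, hδ, hthick⟩ := (hdisj.mono inter_subset_right inter_subset_right :
    Disjoint (S ∩ u) (S ∩ v)).exists_thickenings (hcpt.inter_right hu) (hclosed.inter hv)
  have hnear : ∀ᶠ n in atTop, x n ∈ thickening (δ / 2) (S ∩ u) ∪ thickening (δ / 2) (S ∩ v) := by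
    by_contra hcon
    set T := thickening (δ / 2) (S ∩ u) ∪ thickening (δ / 2) (S ∩ v)
    have hTo : IsOpen T := isOpen_thickening.union isOpen_thickening
    have hfr : ∃ᶠ n in atTop, x n ∈ K \ T :=
      (not_eventually.1 hcon).mono fun n hn => ⟨hx n, hn⟩
    obtain ⟨w, hwT, hw⟩ := (hK.diff hTo).exists_mapClusterPt_of_frequently hfr
    apply hwT.2
    rcases huv hw with h | h
    · exact Or.inl (self_subset_thickening (half_pos hδ) _ ⟨hw, h⟩)
    · exact Or.inr (self_subset_thickening (half_pos hδ) _ ⟨hw, h⟩)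
  have hsmall : ∀ᶠ n in atTop, dist (x (n + 1)) (x n) < δ / 2 :=
    hstep.eventually_lt_const (half_pos hδ)
  obtain ⟨N, hN⟩ := eventually_atTop.1 (hnear.and hsmall)
  have confine : ∀ s t : Set X, Disjoint (thickening δ (S ∩ s)) (thickening δ (S ∩ t)) →
      S ⊆ s ∪ t → (∀ᶠ n in atTop, x n ∈ thickening (δ / 2) (S ∩ s)) → S ⊆ s := by
    intro s t hst hsub hev w hw
    refine (hsub hw).resolve_right fun hwt => ?_
    obtain ⟨n, hn, hn'⟩ := ((hw.frequently (isOpen_thickening.mem_nhds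
      (self_subset_thickening hδ (S ∩ t) ⟨hw, hwt⟩))).and_eventually hev).exists
    exact Set.disjoint_left.1 hst (thickening_mono (by linarith) _ hn') hn
  by_cases hex : ∃ n ≥ N, x n ∈ thickening (δ / 2) (S ∩ u)
  · left
    obtain ⟨m, hm, hmu⟩ := hex
    refine confine u v hthick huv (eventually_atTop.2 ⟨m, fun n hn => ?_⟩)
    induction n, hn using Nat.le_induction with
    | base => exact hmu
    | succ n hn ih =>
      refine (hN (n + 1) (by omega)).1.resolve_right fun hv' => ?_
      obtain ⟨y, hy, hyd⟩ := mem_thickening_iff.1 ih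
      refine Set.disjoint_left.1 hthick (mem_thickening_iff.2 ⟨y, hy, ?_⟩)
        (thickening_mono (by linarith) _ hv')
      linarith [dist_triangle (x (n + 1)) (x n) y, (hN n (by omega)).2]
  · right
    refine confine v u hthick.symm (by rwa [union_comm])
      (eventually_atTop.2 ⟨N, fun n hn => ?_⟩)
    exact (hN n hn).1.resolve_left fun h => hex ⟨n, hn, h⟩

/-- In a bounded domain, consecutive points of an orbit converging to the frontier under a
holomorphic self-map become arbitrarily close. -/
theorem tendsto_dist_iterate_succ_of_tendsto_infDist_frontier {U : Set ℂ} (hUopen : IsOpen U)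
    (hUconn : IsConnected U) (hUbdd : Bornology.IsBounded U) {f : ℂ → ℂ}
    (hf : DifferentiableOn ℂ f U) (hfU : MapsTo f U U) {z : ℂ} (hz : z ∈ U)
    (hfr : (frontier U).Nonempty)
    (hesc : Tendsto (fun n : ℕ => infDist (f^[n] z) (frontier U)) atTop (𝓝 0)) :
    Tendsto (fun n => dist (f^[n + 1] z) (f^[n] z)) atTop (𝓝 0) := by
  have hclosed : IsClosed (frontier U) := isClosed_frontier
  choose a ha had using fun n => hclosed.exists_infDist_eq_dist hfr (f^[n] z)
  have hmaps : ∀ n, MapsTo f^[n] U U := fun n => hfU.iterate n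
  have hdiff : ∀ n, DifferentiableOn ℂ f^[n] U := fun n => hf.iterate hfU n
  have hza : Tendsto (fun n => f^[n] z - a n) atTop (𝓝 0) := by
    rw [tendsto_zero_iff_norm_tendsto_zero]
    simpa only [← dist_eq_norm, ← had] using hesc
  have hfza : Tendsto (fun n => f^[n] (f z) - a n) atTop (𝓝 0) := by
    refine tendsto_zero_of_tendsto_zero_of_ne_zero (g := fun n x => f^[n] x - a n)
      (M := diam (closure U) + 1) hUopen hUconn.isPreconnected
      (fun n => (hdiff n).sub_const _) (fun n x hx h => ?_) (fun n x hx => ?_) hz (hfU hz) hza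
    · have hmem := ha n
      rw [← sub_eq_zero.1 h, hUopen.frontier_eq] at hmem
      exact hmem.2 (hmaps n hx)
    · rw [← dist_eq_norm]
      exact (dist_le_diam_of_mem hUbdd.closure (subset_closure (hmaps n hx))
        (frontier_subset_closure (ha n))).trans_lt (lt_add_one _)
  have := (hfza.sub hza).norm
  simpa [dist_eq_norm, Function.iterate_succ_apply] using this

/-- **The ω-limit set of an escaping orbit is a continuum in the frontier.**
Let `U ⊆ ℂ` be a bounded domain, `f` holomorphic on `U` with `f(U) ⊆ U`, and `z ∈ U`
with `dist (f^[n] z) (∂U) → 0`.  Then the set of accumulation points of the orbit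
`(f^[n] z)` is a nonempty, compact, connected subset of `∂U`. -/
theorem orbit_accumulation_set_is_continuum
    (U : Set ℂ) (hUopen : IsOpen U) (hUconn : IsConnected U)
    (hUbdd : Bornology.IsBounded U)
    (f : ℂ → ℂ) (hf : DifferentiableOn ℂ f U) (hfU : Set.MapsTo f U U)
    (z : ℂ) (hz : z ∈ U)
    (hesc : Filter.Tendsto (fun n : ℕ => Metric.infDist (f^[n] z) (frontier U))
      Filter.atTop (nhds 0)) :
    {w : ℂ | ∃ k : ℕ → ℕ, StrictMono k ∧
        Filter.Tendsto (fun j => f^[k j] z) Filter.atTop (nhds w)}.Nonempty ∧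
    IsCompact {w : ℂ | ∃ k : ℕ → ℕ, StrictMono k ∧
        Filter.Tendsto (fun j => f^[k j] z) Filter.atTop (nhds w)} ∧
    IsConnected {w : ℂ | ∃ k : ℕ → ℕ, StrictMono k ∧
        Filter.Tendsto (fun j => f^[k j] z) Filter.atTop (nhds w)} ∧
    {w : ℂ | ∃ k : ℕ → ℕ, StrictMono k ∧
        Filter.Tendsto (fun j => f^[k j] z) Filter.atTop (nhds w)} ⊆ frontier U := by
  have hcpt : IsCompact (closure U) := hUbdd.isCompact_closure
  have hmem : ∀ n, f^[n] z ∈ closure U := fun n => subset_closure (hfU.iterate n hz)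
  have hfr : (frontier U).Nonempty := by
    rw [nonempty_iff_ne_empty, Ne, ← isClopen_iff_frontier_eq_empty, isClopen_iff]
    rintro (rfl | rfl)
    · exact hz
    · exact NormedSpace.unbounded_univ ℂ ℂ hUbdd
  have hset : {w : ℂ | ∃ k : ℕ → ℕ, StrictMono k ∧
      Tendsto (fun j => f^[k j] z) atTop (𝓝 w)} =
      {w | MapClusterPt w atTop fun n => f^[n] z} := by
    ext w
    constructor
    · rintro ⟨k, hk, hw⟩
      exact hw.mapClusterPt.of_comp hk.tendsto_atTop
    · exact fun hw => hw.tendsto_subseq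
  have hne : {w | MapClusterPt w atTop fun n => f^[n] z}.Nonempty := by
    obtain ⟨w, -, hw⟩ := hcpt.exists_mapClusterPt_of_frequently
      (Frequently.of_forall (f := atTop) hmem)
    exact ⟨w, hw⟩
  have hpre := isPreconnected_setOf_mapClusterPt hcpt hmem
    (tendsto_dist_iterate_succ_of_tendsto_infDist_frontier hUopen hUconn hUbdd hf hfU hz hfr hesc)
  have hsub : {w : ℂ | ∃ k : ℕ → ℕ, StrictMono k ∧
      Tendsto (fun j => f^[k j] z) atTop (𝓝 w)} ⊆ frontier U := by
    rintro w ⟨k, hk, hw⟩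
    have h0 := tendsto_nhds_unique (((continuous_infDist_pt (frontier U)).tendsto w).comp hw)
      (hesc.comp hk.tendsto_atTop)
    exact (isClosed_frontier.mem_iff_infDist_zero hfr).2 h0
  rw [hset] at hsub ⊢
  exact ⟨hne, hcpt.of_isClosed_subset isClosed_setOfPred_clusterPt
    (hsub.trans frontier_subset_closure), ⟨hne, hpre⟩, hsub⟩
end
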